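/- Let n ≥ 2 and let A(s), B(s) ∈ F[s]^{n×n} be regular pencils with homogeneous invariant factors φ₁ | ⋯ | φ_n and ψ₁ | ⋯ | ψ_n respectively. Assume there is some c ∈ F ∪ {∞} that is not an eigenvalue of A(s) nor of B(s). Let 0 ≤ r ≤ n. Then there exists a pencil P(s) ∈ F[s]^{n×n} with normal rank exactly r such that A(s) + P(s) is strictly equivalent to B(s), if and only if φ_{i−r}(s,t) | ψ_i(s,t) | φ_{i+r}(s,t) for all 1 ≤ i ≤ n. -/

import Mathlib

/-- A polynomial matrix is a (matrix) pencil if every entry has degree at most 1. -/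
def IsPencil {F : Type*} [Field F] {m n : ℕ} (M : Matrix (Fin m) (Fin n) (Polynomial F)) : Prop :=
  ∀ i j, (M i j).degree ≤ 1

/-- Normal rank of a polynomial matrix: its rank over the field of rational functions. -/
noncomputable def normalRank {F : Type*} [Field F] {m n : ℕ}
    (M : Matrix (Fin m) (Fin n) (Polynomial F)) : ℕ :=
  (M.map (algebraMap (Polynomial F) (RatFunc F))).rank

/-- Strict equivalence of polynomial matrices (pencils):
`G = Q * H * R` for invertible constant matrices `Q`, `R`. -/
def StrictEquiv {F : Type*} [Field F] {m n : ℕ}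
    (G H : Matrix (Fin m) (Fin n) (Polynomial F)) : Prop :=
  ∃ (Q : Matrix (Fin m) (Fin m) F) (R : Matrix (Fin n) (Fin n) F),
    IsUnit Q.det ∧ IsUnit R.det ∧ G = (Q.map Polynomial.C) * H * (R.map Polynomial.C)

/-- The pencil `G₀ + s G₁` as a polynomial matrix. -/
noncomputable def pencilOf {F : Type*} [Field F] {m n : ℕ}
    (G₀ G₁ : Matrix (Fin m) (Fin n) F) : Matrix (Fin m) (Fin n) (Polynomial F) :=
  G₀.map Polynomial.C + (Polynomial.X : Polynomial F) • G₁.map Polynomial.C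

/-- The homogeneous pencil `t G₀ + s G₁` (variables `s = X 0`, `t = X 1`). -/
noncomputable def homPencil {F : Type*} [Field F] {m n : ℕ}
    (G₀ G₁ : Matrix (Fin m) (Fin n) F) : Matrix (Fin m) (Fin n) (MvPolynomial (Fin 2) F) :=
  (MvPolynomial.X 1 : MvPolynomial (Fin 2) F) • G₀.map MvPolynomial.C +
    (MvPolynomial.X 0 : MvPolynomial (Fin 2) F) • G₁.map MvPolynomial.C

/-- The set of `k × k` minors of a matrix. -/
def minorsSet {R : Type*} [CommRing R] {m n : ℕ} (M : Matrix (Fin m) (Fin n) R) (k : ℕ) :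
    Set R :=
  { d | ∃ (ri : Fin k → Fin m) (ci : Fin k → Fin n),
      Function.Injective ri ∧ Function.Injective ci ∧ d = (M.submatrix ri ci).det }

/-- `g` is a greatest common divisor of the set `S`. -/
def IsGCDOf {R : Type*} [CommRing R] (g : R) (S : Set R) : Prop :=
  (∀ x ∈ S, g ∣ x) ∧ ∀ d : R, (∀ x ∈ S, d ∣ x) → d ∣ g

/-- `φ 0, …, φ (n-1)` are homogeneous invariant factors (up to units) of the pencil
`G₀ + s G₁`: for each `k ≤ n` the product of the first `k` of them is a gcd of the
`k × k` minors of the homogeneous pencil `t G₀ + s G₁`. -/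
def IsHomogeneousIF {F : Type*} [Field F] {n : ℕ} (G₀ G₁ : Matrix (Fin n) (Fin n) F)
    (φ : ℕ → MvPolynomial (Fin 2) F) : Prop :=
  ∀ k : ℕ, k ≤ n → IsGCDOf (∏ i ∈ Finset.range k, φ i) (minorsSet (homPencil G₀ G₁) k)

/-- Extension of a finite family of invariant factors (indexed `1, …, n`, stored with
offset `1` so that `φ 0` is the first one) to all integer indices, with the convention
that it is `1` below the range and `0` above it. -/
def extIF {R : Type*} [CommRing R] (n : ℕ) (φ : ℕ → R) : ℤ → R :=
  fun j => if j < 1 then 1 else if (n : ℤ) < j then 0 else φ (j - 1).toNat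

/-- Interlacing condition `φ_{i-r} ∣ ψ_i ∣ φ_{i+r}`, `1 ≤ i ≤ n`. -/
def Interlace {R : Type*} [CommRing R] (n r : ℕ) (φ ψ : ℕ → R) : Prop :=
  ∀ i : ℕ, 1 ≤ i → i ≤ n →
    extIF n φ ((i : ℤ) - r) ∣ extIF n ψ (i : ℤ) ∧
      extIF n ψ (i : ℤ) ∣ extIF n φ ((i : ℤ) + r)

/-- The operation `P_X` on pencils, acting on the pair `(G₀, G₁)` of coefficients of
`G(s) = G₀ + s G₁`: for `X = [[x, y], [z, w]]`,
`P_X(s G₁ + G₀) = s (x G₁ + z G₀) + (y G₁ + w G₀)`. -/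
def mapP {F : Type*} [Field F] {m n : ℕ} (X : Matrix (Fin 2) (Fin 2) F)
    (G : Matrix (Fin m) (Fin n) F × Matrix (Fin m) (Fin n) F) :
    Matrix (Fin m) (Fin n) F × Matrix (Fin m) (Fin n) F :=
  (X 0 1 • G.2 + X 1 1 • G.1, X 0 0 • G.2 + X 1 0 • G.1)

/-- The substitution `Π_X(Φ)(s, t) = Φ(s x + t y, s z + t w)` for `X = [[x, y], [z, w]]`. -/
noncomputable def PiX {F : Type*} [Field F] (X : Matrix (Fin 2) (Fin 2) F)
    (Φ : MvPolynomial (Fin 2) F) : MvPolynomial (Fin 2) F :=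
  MvPolynomial.aeval
    ![MvPolynomial.C (X 0 0) * MvPolynomial.X 0 + MvPolynomial.C (X 0 1) * MvPolynomial.X 1,
      MvPolynomial.C (X 1 0) * MvPolynomial.X 0 + MvPolynomial.C (X 1 1) * MvPolynomial.X 1] Φ

/-- The homogeneous invariant factor of a nonzero `1 × 1` pencil `a(s) = a₀ + s a₁`:
the homogenization `t a₀ + s a₁`, made monic with respect to `s`
(equal to `t` when `a₁ = 0`). -/
noncomputable def homIF1 {F : Type*} [Field F] (a : Polynomial F) : MvPolynomial (Fin 2) F :=
  MvPolynomial.C (a.leadingCoeff)⁻¹ *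
    (MvPolynomial.C (a.coeff 1) * MvPolynomial.X 0 + MvPolynomial.C (a.coeff 0) * MvPolynomial.X 1)

/-- The homogeneous pencil associated to a polynomial matrix pencil. -/
noncomputable def homOf {F : Type*} [Field F] {n : ℕ}
    (M : Matrix (Fin n) (Fin n) (Polynomial F)) : Matrix (Fin n) (Fin n) (MvPolynomial (Fin 2) F) :=
  homPencil (M.map fun p => p.coeff 0) (M.map fun p => p.coeff 1)

section

open Polynomial

/-- Unimodular equivalence of square matrices over a commutative ring. -/
def UEquiv {R : Type*} [CommRing R] {n : ℕ} (M N : Matrix (Fin n) (Fin n) R) : Prop :=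
  ∃ U V : Matrix (Fin n) (Fin n) R, IsUnit U.det ∧ IsUnit V.det ∧ M = U * N * V

namespace UEquiv

variable {R : Type*} [CommRing R] {n : ℕ} {M N K : Matrix (Fin n) (Fin n) R}

theorem refl (M : Matrix (Fin n) (Fin n) R) : UEquiv M M := ⟨1, 1, by simp, by simp, by simp⟩

theorem trans (h₁ : UEquiv M N) (h₂ : UEquiv N K) : UEquiv M K := by
  obtain ⟨U, V, hU, hV, rfl⟩ := h₁
  obtain ⟨U', V', hU', hV', rfl⟩ := h₂
  exact ⟨U * U', V' * V, by simpa using ⟨hU, hU'⟩, by simpa using ⟨hV', hV⟩, by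
    simp only [Matrix.mul_assoc]⟩

theorem symm (h : UEquiv M N) : UEquiv N M := by
  obtain ⟨U, V, hU, hV, rfl⟩ := h
  refine ⟨U⁻¹, V⁻¹, ?_, ?_, ?_⟩
  · exact Matrix.isUnit_nonsing_inv_det _ hU
  · exact Matrix.isUnit_nonsing_inv_det _ hV
  · rw [Matrix.mul_assoc U N V, Matrix.nonsing_inv_mul_cancel_left _ _ hU,
      Matrix.mul_nonsing_inv_cancel_right _ _ hV]

theorem of_left_mul {U : Matrix (Fin n) (Fin n) R} (hU : IsUnit U.det)
    (M : Matrix (Fin n) (Fin n) R) : UEquiv (U * M) M :=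
  ⟨U, 1, hU, by simp, by simp⟩

theorem of_right_mul {V : Matrix (Fin n) (Fin n) R} (hV : IsUnit V.det)
    (M : Matrix (Fin n) (Fin n) R) : UEquiv (M * V) M :=
  ⟨1, V, by simp, hV, by simp⟩

theorem transpose (h : UEquiv M N) : UEquiv M.transpose N.transpose := by
  obtain ⟨U, V, hU, hV, rfl⟩ := h
  exact ⟨V.transpose, U.transpose, by simpa, by simpa, by
    simp [Matrix.transpose_mul, Matrix.mul_assoc]⟩

theorem submatrix_left (M : Matrix (Fin n) (Fin n) R) (σ : Equiv.Perm (Fin n)) :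
    UEquiv (M.submatrix σ id) M := by
  rw [← PEquiv.toMatrix_toPEquiv_mul]
  refine of_left_mul ?_ M
  rw [show (Equiv.toPEquiv σ).toMatrix = σ.permMatrix R from rfl, Matrix.det_permutation]
  exact (Units.map (Int.castRingHom R).toMonoidHom (Equiv.Perm.sign σ)).isUnit

theorem submatrix_right (M : Matrix (Fin n) (Fin n) R) (σ : Equiv.Perm (Fin n)) :
    UEquiv (M.submatrix id σ) M := by
  simpa using (submatrix_left M.transpose σ).transpose

end UEquiv

/-- The block diagonal matrix with blocks `d` and `M`. -/
def bordered {R : Type*} [CommRing R] {n : ℕ} (d : R) (M : Matrix (Fin n) (Fin n) R) :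
    Matrix (Fin (n + 1)) (Fin (n + 1)) R :=
  Matrix.of (Fin.cons (Fin.cons d 0) fun i => Fin.cons 0 (M i))

section bordered

variable {R : Type*} [CommRing R] {n : ℕ} (d e : R) (M N : Matrix (Fin n) (Fin n) R)

@[simp] theorem bordered_zero_zero : bordered d M 0 0 = d := rfl
@[simp] theorem bordered_zero_succ (j : Fin n) : bordered d M 0 j.succ = 0 := rfl
@[simp] theorem bordered_succ_zero (i : Fin n) : bordered d M i.succ 0 = 0 := rfl
@[simp] theorem bordered_succ_succ (i j : Fin n) : bordered d M i.succ j.succ = M i j := rfl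

theorem bordered_mul : bordered d M * bordered e N = bordered (d * e) (M * N) := by
  ext i j
  refine Fin.cases ?_ (fun i => ?_) i <;> refine Fin.cases ?_ (fun j => ?_) j <;>
    simp [Matrix.mul_apply, Fin.sum_univ_succ]

theorem det_bordered : (bordered d M).det = d * M.det := by
  rw [Matrix.det_succ_row_zero, Fin.sum_univ_succ]
  simp only [bordered_zero_zero, bordered_zero_succ]
  have : (bordered d M).submatrix Fin.succ Fin.succ = M := by
    ext i j; simp
  simp [this]

theorem UEquiv.bordered {M N : Matrix (Fin n) (Fin n) R} (h : UEquiv M N) :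
    UEquiv (bordered d M) (bordered d N) := by
  obtain ⟨U, V, hU, hV, rfl⟩ := h
  exact ⟨_root_.bordered 1 U, _root_.bordered 1 V, by simpa [det_bordered],
    by simpa [det_bordered], by simp [bordered_mul]⟩

theorem bordered_diagonal (α : ℕ → R) :
    bordered (α 0) (Matrix.diagonal fun i : Fin n => α (i + 1)) =
      Matrix.diagonal fun i : Fin (n + 1) => α i := by
  ext i j
  refine Fin.cases ?_ (fun i => ?_) i <;> refine Fin.cases ?_ (fun j => ?_) j <;>
    simp [Matrix.diagonal_apply, Fin.succ_ne_zero, (Fin.succ_ne_zero _).symm]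

end bordered

section lowerBorder

variable {R : Type*} [CommRing R] {n : ℕ}

/-- The lower unitriangular matrix with first column `(1, c)` and identity elsewhere. -/
def lowerBorder (c : Fin n → R) : Matrix (Fin (n + 1)) (Fin (n + 1)) R :=
  Matrix.of (Fin.cons (Fin.cons 1 0) fun i => Fin.cons (c i) ((1 : Matrix (Fin n) (Fin n) R) i))

variable (c : Fin n → R)

@[simp] theorem lowerBorder_zero_zero : lowerBorder c 0 0 = 1 := rfl
@[simp] theorem lowerBorder_zero_succ (j : Fin n) : lowerBorder c 0 j.succ = 0 := rfl
@[simp] theorem lowerBorder_succ_zero (i : Fin n) : lowerBorder c i.succ 0 = c i := rfl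
@[simp] theorem lowerBorder_succ_succ (i j : Fin n) :
    lowerBorder c i.succ j.succ = (1 : Matrix (Fin n) (Fin n) R) i j := rfl

theorem det_lowerBorder : (lowerBorder c).det = 1 := by
  rw [Matrix.det_succ_row_zero, Fin.sum_univ_succ]
  simp only [lowerBorder_zero_zero, lowerBorder_zero_succ]
  have : (lowerBorder c).submatrix Fin.succ Fin.succ = 1 := by
    ext i j; simp
  simp [this]

end lowerBorder


section Smith

variable {F : Type*} [Field F] {n : ℕ}

/-- If `d` has minimal degree among the nonzero corner entries of the matrices equivalent to `M`,
then it divides the first column of each equivalent matrix with corner `d`. -/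
theorem corner_dvd_column {M N : Matrix (Fin (n + 1)) (Fin (n + 1)) F[X]} {d : F[X]} (hd : d ≠ 0)
    (hmin : ∀ N, UEquiv N M → N 0 0 ≠ 0 → d.degree ≤ (N 0 0).degree)
    (hN : UEquiv N M) (hN0 : N 0 0 = d) (i : Fin n) : d ∣ N i.succ 0 := by
  by_contra hdvd
  set N' := (Matrix.transvection i.succ 0 (-(N i.succ 0 / d)) * N).submatrix
    (Equiv.swap 0 i.succ) id with hN'
  have hN'e : UEquiv N' M := by
    refine (UEquiv.submatrix_left _ _).trans ((UEquiv.of_left_mul ?_ N).trans hN)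
    rw [Matrix.det_transvection_of_ne _ _ (Fin.succ_ne_zero i)]; exact isUnit_one
  have h00 : N' 0 0 = N i.succ 0 % d := by
    simp only [hN', Matrix.submatrix_apply, Equiv.swap_apply_left, id,
      Matrix.transvection_mul_apply_same, hN0]
    rw [EuclideanDomain.mod_eq_sub_mul_div]; ring
  have hne : N' 0 0 ≠ 0 := by
    rw [h00]; exact fun h => hdvd ((EuclideanDomain.mod_eq_zero).1 h)
  have := hmin N' hN'e hne
  rw [h00] at this
  exact absurd this (not_le.2 (EuclideanDomain.mod_lt _ hd))

theorem exists_bordered_of_ne_zero {M : Matrix (Fin (n + 1)) (Fin (n + 1)) F[X]} (hM : M ≠ 0) :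
    ∃ (d : F[X]) (M' : Matrix (Fin n) (Fin n) F[X]),
      UEquiv M (bordered d M') ∧ ∀ i j, d ∣ M' i j := by
  classical
  obtain ⟨N, ⟨hN, hN0⟩, hmin⟩ : ∃ N, (UEquiv N M ∧ N 0 0 ≠ 0) ∧
      ∀ N', UEquiv N' M → N' 0 0 ≠ 0 → (N 0 0).degree ≤ (N' 0 0).degree := by
    obtain ⟨i, j, hij⟩ : ∃ i j, M i j ≠ 0 := by
      by_contra! h; exact hM (Matrix.ext h)
    have hne : {N | UEquiv N M ∧ N 0 0 ≠ 0}.Nonempty :=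
      ⟨(M.submatrix (Equiv.swap 0 i) id).submatrix id (Equiv.swap 0 j),
        (UEquiv.submatrix_right _ _).trans (UEquiv.submatrix_left _ _), by simpa using hij⟩
    have wf := (InvImage.wf (fun N : Matrix (Fin (n + 1)) (Fin (n + 1)) F[X] => (N 0 0).degree)
      wellFounded_lt)
    exact ⟨wf.min _ hne, wf.min_mem _ hne, fun N' h1 h2 =>
      not_lt.1 (wf.not_lt_min (s := {N | UEquiv N M ∧ N 0 0 ≠ 0}) (x := N') ⟨h1, h2⟩)⟩
  set d := N 0 0 with hd
  have hminT : ∀ N', UEquiv N' M.transpose → N' 0 0 ≠ 0 → d.degree ≤ (N' 0 0).degree :=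
    fun N' h1 h2 => by simpa using hmin N'.transpose (by simpa using h1.transpose) (by simpa)
  choose c hc using fun i => corner_dvd_column hN0 hmin hN rfl i
  have hrow : ∀ N', UEquiv N' M → N' 0 0 = d → ∀ j : Fin n, d ∣ N' 0 j.succ := fun N' h1 h2 j =>
    corner_dvd_column (N := N'.transpose) hN0 hminT h1.transpose h2 j
  choose b hb using hrow N hN rfl
  set M' : Matrix (Fin n) (Fin n) F[X] :=
    Matrix.of fun i j => N i.succ j.succ - c i * d * b j with hM'
  have hd' : N 0 0 = d := rfl
  have hNM' : N = lowerBorder c * bordered d M' * (lowerBorder b).transpose := by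
    ext i j
    refine Fin.cases ?_ (fun i => ?_) i <;> refine Fin.cases ?_ (fun j => ?_) j <;>
      simp [Matrix.mul_apply, Fin.sum_univ_succ, Matrix.one_apply, hc, hb, hd',
        hM']
    ring_nf
  have hNb : UEquiv N (bordered d M') :=
    ⟨_, _, by simp [det_lowerBorder], by simp [det_lowerBorder], hNM'⟩
  refine ⟨d, M', hN.symm.trans hNb, fun i j => ?_⟩
  have := hrow (Matrix.transvection 0 i.succ 1 * bordered d M') ((UEquiv.of_left_mul (by
    rw [Matrix.det_transvection_of_ne _ _ (Fin.succ_ne_zero i).symm]; exact isUnit_one) _).trans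
    (hNb.symm.trans hN)) (by simp) j
  simpa using this

/-- Smith normal form over a polynomial ring. -/
theorem exists_smith_aux : ∀ (n : ℕ) (M : Matrix (Fin n) (Fin n) F[X]) (d : F[X]),
    (∀ i j, d ∣ M i j) → ∃ α : ℕ → F[X], (∀ i, d ∣ α i) ∧ (∀ i, α i ∣ α (i + 1)) ∧
      UEquiv M (Matrix.diagonal fun i : Fin n => α i)
  | 0, M, d, _ => ⟨fun _ => d, fun _ => dvd_rfl, fun _ => dvd_rfl, by
      rw [Subsingleton.elim M (Matrix.diagonal _)]; exact UEquiv.refl _⟩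
  | n + 1, M, d, hd => by
    by_cases hM : M = 0
    · refine ⟨fun _ => 0, fun _ => dvd_zero _, fun _ => dvd_rfl, ?_⟩
      rw [hM]
      simp only [Matrix.diagonal_zero]
      exact UEquiv.refl _
    · obtain ⟨e, M', hMM', he⟩ := exists_bordered_of_ne_zero hM
      obtain ⟨α, h1, h2, h3⟩ := exists_smith_aux n M' e he
      have hde : d ∣ e := by
        obtain ⟨U, V, -, -, h⟩ := hMM'.symm
        rw [← bordered_zero_zero e M', h]
        simp only [Matrix.mul_apply, Finset.sum_mul]
        exact Finset.dvd_sum fun i _ => Finset.dvd_sum fun j _ =>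
          (((hd j i).mul_left _)).mul_right _
      refine ⟨fun i => Nat.casesOn i e α, ?_, ?_, ?_⟩
      · rintro (_ | i)
        exacts [hde, hde.trans (h1 i)]
      · rintro (_ | i)
        exacts [h1 0, h2 i]
      · rw [← bordered_diagonal]
        exact hMM'.trans (h3.bordered e)

/-- Monic Smith normal form of a nonsingular polynomial matrix. -/
theorem exists_smith (M : Matrix (Fin n) (Fin n) F[X]) (hM : M.det ≠ 0) :
    ∃ α : ℕ → F[X], (∀ i < n, (α i).Monic) ∧ (∀ i, α i ∣ α (i + 1)) ∧
      UEquiv M (Matrix.diagonal fun i : Fin n => α i) := by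
  classical
  obtain ⟨α, -, h2, h3⟩ := exists_smith_aux n M 1 fun _ _ => one_dvd _
  refine ⟨fun i => normalize (α i), fun i hi => ?_, fun i => ?_, h3.trans ?_⟩
  · refine Polynomial.monic_normalize fun h0 => hM ?_
    obtain ⟨U, V, -, -, rfl⟩ := h3
    rw [Matrix.det_mul, Matrix.det_mul, Matrix.det_diagonal,
      Finset.prod_eq_zero (Finset.mem_univ ⟨i, hi⟩) h0]
    simp
  · exact normalize_dvd_iff.2 (dvd_normalize_iff.2 (h2 i))
  · refine UEquiv.symm ⟨1, Matrix.diagonal fun i : Fin n => (normUnit (α i) : F[X]),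
      by simp, ?_, ?_⟩
    · rw [Matrix.det_diagonal]
      exact IsUnit.prod_univ_iff.2 fun i => Units.isUnit _
    · simp [normalize_apply]

end Smith

section Minors

variable {R : Type*} [CommRing R] {n k : ℕ}

theorem dvd_minors_left_mul {d : R} {N : Matrix (Fin n) (Fin n) R}
    (h : ∀ x ∈ minorsSet N k, d ∣ x) (A : Matrix (Fin n) (Fin n) R) :
    ∀ x ∈ minorsSet (A * N) k, d ∣ x := by
  rintro _ ⟨ri, ci, -, hci, rfl⟩
  have hrows : (A * N).submatrix ri ci =
      fun i => ∑ l, A (ri i) l • (fun j => N l (ci j)) := by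
    ext i j
    simp [Matrix.mul_apply, Finset.sum_apply]
  have hexp : ((A * N).submatrix ri ci).det =
      ∑ f : Fin k → Fin n, (∏ i, A (ri i) (f i)) * (N.submatrix f ci).det := by
    rw [hrows]
    have := (Matrix.detRowAlternating (R := R) (n := Fin k)).toMultilinearMap.map_sum
      (g := fun i l => A (ri i) l • (fun j => N l (ci j)))
    refine this.trans (Finset.sum_congr rfl fun f _ => ?_)
    refine ((Matrix.detRowAlternating (R := R) (n := Fin k)).toMultilinearMap.map_smul_univ
      (fun i => A (ri i) (f i)) (fun i j => N (f i) (ci j))).trans ?_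
    rfl
  rw [hexp]
  refine Finset.dvd_sum fun f _ => ?_
  by_cases hf : Function.Injective f
  · exact (h _ ⟨f, ci, hf, hci, rfl⟩).mul_left _
  · obtain ⟨i, j, hij, hne⟩ := Function.not_injective_iff.1 hf
    rw [Matrix.det_zero_of_row_eq hne (by ext l; simp [hij])]
    simp

theorem minorsSet_transpose (N : Matrix (Fin n) (Fin n) R) :
    minorsSet N.transpose k = minorsSet N k := by
  ext x
  constructor
  · rintro ⟨ri, ci, h1, h2, rfl⟩
    exact ⟨ci, ri, h2, h1, by rw [← Matrix.det_transpose]; rfl⟩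
  · rintro ⟨ri, ci, h1, h2, rfl⟩
    exact ⟨ci, ri, h2, h1, by rw [← Matrix.det_transpose]; rfl⟩

theorem UEquiv.dvd_minors {d : R} {M N : Matrix (Fin n) (Fin n) R} (hMN : UEquiv M N)
    (h : ∀ x ∈ minorsSet N k, d ∣ x) : ∀ x ∈ minorsSet M k, d ∣ x := by
  obtain ⟨U, V, -, -, rfl⟩ := hMN
  rw [← minorsSet_transpose, Matrix.transpose_mul]
  refine dvd_minors_left_mul ?_ _
  rw [minorsSet_transpose]
  exact dvd_minors_left_mul h _

theorem UEquiv.isGCDOf_minors {g : R} {M N : Matrix (Fin n) (Fin n) R} (hMN : UEquiv M N)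
    (h : IsGCDOf g (minorsSet N k)) : IsGCDOf g (minorsSet M k) :=
  ⟨hMN.dvd_minors h.1, fun d hd => h.2 d (hMN.symm.dvd_minors hd)⟩

theorem dvd_of_le_of_chain {α : ℕ → R} (hα : ∀ i, α i ∣ α (i + 1)) {i j : ℕ} (h : i ≤ j) :
    α i ∣ α j := by
  induction h with
  | refl => exact dvd_rfl
  | step _ ih => exact ih.trans (hα _)

theorem prod_range_dvd_prod_of_injective {α : ℕ → R} (hα : ∀ i, α i ∣ α (i + 1)) :
    ∀ (k : ℕ) (c : Fin k → ℕ), Function.Injective c →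
      ∏ i ∈ Finset.range k, α i ∣ ∏ i, α (c i)
  | 0, _, _ => by simp
  | k + 1, c, hc => by
    obtain ⟨j, hj⟩ : ∃ j, k ≤ c j := by
      by_contra! h
      have := Fintype.card_le_of_injective (fun j => (⟨c j, h j⟩ : Fin k))
        (fun a b hab => hc (by simpa using hab))
      simp at this
    rw [Fin.prod_univ_succAbove _ j, Finset.prod_range_succ, mul_comm]
    exact mul_dvd_mul (dvd_of_le_of_chain hα hj)
      (prod_range_dvd_prod_of_injective hα k _ (hc.comp Fin.succAbove_right_injective))

theorem isGCDOf_minors_diagonal {α : ℕ → R} (hα : ∀ i, α i ∣ α (i + 1)) (hk : k ≤ n) :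
    IsGCDOf (∏ i ∈ Finset.range k, α i)
      (minorsSet (Matrix.diagonal fun i : Fin n => α i) k) := by
  constructor
  · rintro _ ⟨ri, ci, -, hci, rfl⟩
    rw [Matrix.det_apply]
    refine Finset.dvd_sum fun σ _ => ?_
    rw [Units.smul_def, zsmul_eq_mul]
    refine Dvd.dvd.mul_left ?_ _
    by_cases h : ∀ i, ri (σ i) = ci i
    · simp only [Matrix.submatrix_apply, h, Matrix.diagonal_apply_eq]
      exact prod_range_dvd_prod_of_injective hα k (fun i => (ci i : ℕ))
        (Fin.val_injective.comp hci)
    · push Not at h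
      obtain ⟨i, hi⟩ := h
      rw [Finset.prod_eq_zero (Finset.mem_univ i) (by simp [hi])]
      exact dvd_zero _
  · intro d hd
    have := hd _ ⟨Fin.castLE hk, Fin.castLE hk, Fin.castLE_injective hk, Fin.castLE_injective hk,
      rfl⟩
    rw [Matrix.submatrix_diagonal _ _ (Fin.castLE_injective hk), Matrix.det_diagonal] at this
    simpa [Finset.prod_range] using this

end Minors

theorem interlace_iff {R : Type*} [CommRing R] {n r : ℕ} {φ ψ : ℕ → R} :
    Interlace n r φ ψ ↔ ∀ i, i + r < n → φ i ∣ ψ (i + r) ∧ ψ i ∣ φ (i + r) := by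
  constructor
  · intro h i hi
    have h1 := (h (i + r + 1) (by omega) (by omega)).1
    have h2 := (h (i + 1) (by omega) (by omega)).2
    simp only [extIF] at h1 h2
    rw [if_neg (by push_cast; omega), if_neg (by push_cast; omega), if_neg (by push_cast; omega),
      if_neg (by push_cast; omega),
      show (((i + r + 1 : ℕ) : ℤ) - r - 1).toNat = i by push_cast; omega,
      show (((i + r + 1 : ℕ) : ℤ) - 1).toNat = i + r by push_cast; omega] at h1
    rw [if_neg (by push_cast; omega), if_neg (by push_cast; omega), if_neg (by push_cast; omega),
      if_neg (by push_cast; omega),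
      show (((i + 1 : ℕ) : ℤ) + r - 1).toNat = i + r by push_cast; omega,
      show (((i + 1 : ℕ) : ℤ) - 1).toNat = i by push_cast; omega] at h2
    exact ⟨h1, h2⟩
  · intro h i h1 hn
    have hi : extIF n ψ i = ψ (i - 1) := by
      simp only [extIF]
      rw [if_neg (by omega), if_neg (by omega), show ((i : ℤ) - 1).toNat = i - 1 by omega]
    rw [hi]
    simp only [extIF]
    constructor
    · split_ifs
      · exact one_dvd _
      · omega
      · have := (h ((i : ℤ) - r - 1).toNat (by omega)).1
        rwa [show ((i : ℤ) - r - 1).toNat + r = i - 1 by omega] at this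
    · split_ifs
      · omega
      · exact dvd_zero _
      · have := (h (i - 1) (by omega)).2
        rwa [show i - 1 + r = ((i : ℤ) + r - 1).toNat by omega] at this

section Dehomogenize

variable {F : Type*} [Field F] {n k : ℕ}

/-- The substitution `t = 1` in a polynomial in `s` and `t`. -/
noncomputable def dehom : MvPolynomial (Fin 2) F →ₐ[F] F[X] := MvPolynomial.aeval ![X, 1]

theorem dehom_dvd {p q : MvPolynomial (Fin 2) F} (h : p ∣ q) : dehom p ∣ dehom q := by
  obtain ⟨c, rfl⟩ := h
  rw [map_mul]
  exact dvd_mul_right _ _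

theorem map_homPencil (G₀ G₁ : Matrix (Fin n) (Fin n) F) :
    (homPencil G₀ G₁).map dehom = pencilOf G₀ G₁ := by
  ext i j : 2
  simp [homPencil, pencilOf, dehom]

theorem dehom_det_submatrix (G₀ G₁ : Matrix (Fin n) (Fin n) F) (ri ci : Fin k → Fin n) :
    dehom ((homPencil G₀ G₁).submatrix ri ci).det = ((pencilOf G₀ G₁).submatrix ri ci).det := by
  rw [AlgHom.map_det, AlgHom.mapMatrix_apply, ← map_homPencil]
  rfl

theorem isHomogeneous_det_submatrix (G₀ G₁ : Matrix (Fin n) (Fin n) F) (ri ci : Fin k → Fin n) :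
    ((homPencil G₀ G₁).submatrix ri ci).det.IsHomogeneous k := by
  rw [Matrix.det_apply']
  refine MvPolynomial.IsHomogeneous.sum _ _ _ fun σ _ => ?_
  have h1 : (∏ i, (homPencil G₀ G₁).submatrix ri ci (σ i) i).IsHomogeneous (∑ _i : Fin k, 1) := by
    refine MvPolynomial.IsHomogeneous.prod _ _ _ fun i _ => ?_
    simp only [homPencil, Matrix.submatrix_apply, Matrix.add_apply, Matrix.smul_apply,
      Matrix.map_apply, smul_eq_mul]
    rw [mul_comm, mul_comm (MvPolynomial.X 0)]
    exact (MvPolynomial.isHomogeneous_C_mul_X _ _).add (MvPolynomial.isHomogeneous_C_mul_X _ _)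
  have h2 : (((Equiv.Perm.sign σ : ℤ) : MvPolynomial (Fin 2) F)).IsHomogeneous 0 := by
    rw [show (((Equiv.Perm.sign σ : ℤ) : MvPolynomial (Fin 2) F)) =
      MvPolynomial.C ((Equiv.Perm.sign σ : ℤ) : F) by simp]
    exact MvPolynomial.isHomogeneous_C _ _
  simpa using h2.mul h1

theorem natDegree_dehom_le (p : MvPolynomial (Fin 2) F) :
    (dehom p).natDegree ≤ p.totalDegree := by
  simpa [dehom] using MvPolynomial.aeval_natDegree_le (n := 1) p le_rfl ![X, 1]
    (fun i => by fin_cases i <;> simp)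

theorem natDegree_det_pencilOf {G₀ G₁ : Matrix (Fin n) (Fin n) F} (h : IsUnit G₁.det) :
    (pencilOf G₀ G₁).det.natDegree = n := by
  rw [pencilOf, add_comm]
  apply le_antisymm
  · simpa using natDegree_det_X_add_C_le G₁ G₀
  · refine le_natDegree_of_ne_zero ?_
    have := coeff_det_X_add_C_card G₁ G₀
    rw [Fintype.card_fin] at this
    rw [this]
    exact h.ne_zero

theorem isUnit_of_isUnit_dehom {e m : MvPolynomial (Fin 2) F} (hem : e ∣ m)
    (hm : dehom m ≠ 0) (hdeg : m.totalDegree ≤ (dehom m).natDegree) (he : IsUnit (dehom e)) :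
    IsUnit e := by
  obtain ⟨f, rfl⟩ := hem
  have hef : e * f ≠ 0 := fun h => hm (by rw [h, map_zero])
  have he0 := left_ne_zero_of_mul hef
  rw [map_mul] at hm hdeg
  rw [MvPolynomial.totalDegree_mul_of_isDomain he0 (right_ne_zero_of_mul hef),
    natDegree_mul (left_ne_zero_of_mul hm) (right_ne_zero_of_mul hm),
    natDegree_eq_zero_of_isUnit he] at hdeg
  have h0 : e.totalDegree = 0 := by
    have := natDegree_dehom_le f
    omega
  rw [MvPolynomial.isUnit_iff_totalDegree_of_isReduced]
  refine ⟨isUnit_iff_ne_zero.2 fun h => he0 ?_, h0⟩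
  rw [MvPolynomial.totalDegree_eq_zero_iff_eq_C.1 h0, h, map_zero]

theorem homogenize_dvd_of_dvd_dehom {p : F[X]} {m : MvPolynomial (Fin 2) F}
    (hm : m.IsHomogeneous k) (h : p ∣ dehom m) : p.homogenize p.natDegree ∣ m := by
  obtain ⟨q, hq⟩ := h
  by_cases h0 : p * q = 0
  · rw [← homogenize_eq_of_isHomogeneous hm rfl]
    rw [dehom] at hq
    rw [hq, h0]
    simp
  · have hdeg : p.natDegree + q.natDegree ≤ k := by
      rw [← natDegree_mul (left_ne_zero_of_mul h0) (right_ne_zero_of_mul h0), ← hq]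
      exact (natDegree_dehom_le m).trans hm.totalDegree_le
    have := homogenize_mul p q (m := p.natDegree) (n := k - p.natDegree) le_rfl (by omega)
    rw [Nat.add_sub_cancel' (by omega), homogenize_eq_of_isHomogeneous hm hq] at this
    exact ⟨_, this⟩

variable {G₀ G₁ : Matrix (Fin n) (Fin n) F} {φ : ℕ → MvPolynomial (Fin 2) F} {α : ℕ → F[X]}

theorem IsHomogeneousIF.associated_prod (h : IsHomogeneousIF G₀ G₁ φ) (hG : IsUnit G₁.det)
    (hα : ∀ i, α i ∣ α (i + 1))
    (hs : UEquiv (pencilOf G₀ G₁) (Matrix.diagonal fun i : Fin n => α i)) (hk : k ≤ n) :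
    Associated ((∏ i ∈ Finset.range k, α i).homogenize (∏ i ∈ Finset.range k, α i).natDegree)
      (∏ i ∈ Finset.range k, φ i) := by
  have hgcd : IsGCDOf (∏ i ∈ Finset.range k, α i) (minorsSet (pencilOf G₀ G₁) k) :=
    hs.isGCDOf_minors (isGCDOf_minors_diagonal hα hk)
  obtain ⟨e, he⟩ : (∏ i ∈ Finset.range k, α i).homogenize (∏ i ∈ Finset.range k, α i).natDegree ∣
      ∏ i ∈ Finset.range k, φ i := by
    refine (h k hk).2 _ ?_
    rintro _ ⟨ri, ci, hri, hci, rfl⟩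
    refine homogenize_dvd_of_dvd_dehom (isHomogeneous_det_submatrix _ _ _ _) ?_
    rw [dehom_det_submatrix]
    exact hgcd.1 _ ⟨ri, ci, hri, hci, rfl⟩
  have hdet : dehom (homPencil G₀ G₁).det = (pencilOf G₀ G₁).det := by
    simpa using dehom_det_submatrix G₀ G₁ id id
  have hdet0 : (pencilOf G₀ G₁).det ≠ 0 := by
    intro h0
    have h1 := natDegree_det_pencilOf (G₀ := G₀) hG
    have h2 := coeff_det_X_add_C_card G₁ G₀
    rw [add_comm, ← pencilOf, h0, coeff_zero] at h2
    exact hG.ne_zero h2.symm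
  have hD : ∏ i ∈ Finset.range k, φ i ∣ (homPencil G₀ G₁).det :=
    (Finset.prod_dvd_prod_of_subset _ _ _ (Finset.range_mono hk)).trans
      ((h n le_rfl).1 _ ⟨id, id, Function.injective_id, Function.injective_id, by simp⟩)
  have hdvd : dehom (∏ i ∈ Finset.range k, φ i) ∣ ∏ i ∈ Finset.range k, α i := by
    refine hgcd.2 _ ?_
    rintro _ ⟨ri, ci, hri, hci, rfl⟩
    rw [← dehom_det_submatrix]
    have h1 : ∏ i ∈ Finset.range k, φ i ∣ ((homPencil G₀ G₁).submatrix ri ci).det :=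
      (h k hk).1 _ ⟨ri, ci, hri, hci, rfl⟩
    exact dehom_dvd h1
  have hα0 : ∏ i ∈ Finset.range k, α i ≠ 0 := by
    intro h0
    have h1 := dehom_dvd hD
    rw [he, map_mul, dehom, aeval_homogenize_X_one _ le_rfl, ← dehom, hdet, h0, zero_mul,
      zero_dvd_iff] at h1
    exact hdet0 h1
  have hu : IsUnit (dehom e) := by
    rw [he, map_mul, dehom, aeval_homogenize_X_one _ le_rfl] at hdvd
    exact isUnit_of_dvd_one ((mul_dvd_mul_iff_left hα0).1 (by rw [mul_one]; exact hdvd))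
  have hue : IsUnit e := by
    refine isUnit_of_isUnit_dehom ((Dvd.intro_left _ he.symm).trans hD) (by rwa [hdet]) ?_ hu
    rw [hdet, natDegree_det_pencilOf hG]
    simpa using (isHomogeneous_det_submatrix G₀ G₁ id id).totalDegree_le
  obtain ⟨u, rfl⟩ := hue
  exact ⟨u, he.symm⟩

theorem IsHomogeneousIF.associated (h : IsHomogeneousIF G₀ G₁ φ) (hG : IsUnit G₁.det)
    (hα : ∀ i, α i ∣ α (i + 1)) (hm : ∀ i < n, (α i).Monic)
    (hs : UEquiv (pencilOf G₀ G₁) (Matrix.diagonal fun i : Fin n => α i)) {i : ℕ} (hi : i < n) :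
    Associated ((α i).homogenize (α i).natDegree) (φ i) := by
  have h1 := h.associated_prod hG hα hs hi.le
  have h2 := h.associated_prod hG hα hs (Nat.succ_le_of_lt hi)
  have hp : (∏ j ∈ Finset.range i, α j).Monic :=
    monic_prod_of_monic _ _ fun j hj => hm j ((Finset.mem_range.1 hj).trans hi)
  rw [Finset.prod_range_succ, Finset.prod_range_succ, hp.natDegree_mul (hm i hi),
    homogenize_mul _ _ le_rfl le_rfl] at h2
  refine Associated.of_mul_left h2 h1 ?_
  rw [Ne, homogenize_eq_zero_iff le_rfl]
  exact hp.ne_zero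

theorem homogenize_natDegree_dvd_iff {p q : F[X]} :
    p.homogenize p.natDegree ∣ q.homogenize q.natDegree ↔ p ∣ q := by
  refine ⟨fun h => ?_, homogenize_dvd⟩
  have := dehom_dvd h
  rwa [dehom, aeval_homogenize_X_one _ le_rfl, aeval_homogenize_X_one _ le_rfl] at this

theorem interlace_iff_of_uEquiv {H₀ H₁ : Matrix (Fin n) (Fin n) F}
    {ψ : ℕ → MvPolynomial (Fin 2) F} {β : ℕ → F[X]}
    (hφ : IsHomogeneousIF G₀ G₁ φ) (hG : IsUnit G₁.det)
    (hα : ∀ i, α i ∣ α (i + 1)) (hαm : ∀ i < n, (α i).Monic)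
    (hαs : UEquiv (pencilOf G₀ G₁) (Matrix.diagonal fun i : Fin n => α i))
    (hψ : IsHomogeneousIF H₀ H₁ ψ) (hH : IsUnit H₁.det)
    (hβ : ∀ i, β i ∣ β (i + 1)) (hβm : ∀ i < n, (β i).Monic)
    (hβs : UEquiv (pencilOf H₀ H₁) (Matrix.diagonal fun i : Fin n => β i)) (r : ℕ) :
    Interlace n r φ ψ ↔ ∀ i, i + r < n → α i ∣ β (i + r) ∧ β i ∣ α (i + r) := by
  rw [interlace_iff]
  refine forall_congr' fun i => imp_congr_right fun hi => ?_
  have h1 := fun {j} (hj : j < n) => hφ.associated hG hα hαm hαs hj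
  have h2 := fun {j} (hj : j < n) => hψ.associated hH hβ hβm hβs hj
  rw [← (h1 (by omega : i < n)).dvd_iff_dvd_left, ← (h2 hi).dvd_iff_dvd_right,
    ← (h2 (by omega : i < n)).dvd_iff_dvd_left, ← (h1 hi).dvd_iff_dvd_right,
    homogenize_natDegree_dvd_iff, homogenize_natDegree_dvd_iff]

end Dehomogenize

section RankMap

variable {K L : Type*} [Field K] [Field L] {n : ℕ}

theorem rank_fromBlocks_one (K : Type*) [Field K] (a b : ℕ) :
    (Matrix.fromBlocks (1 : Matrix (Fin a) (Fin a) K) 0 0 (0 : Matrix (Fin b) (Fin b) K)).rank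
      = a := by
  classical
  rw [← Matrix.diagonal_one, ← Matrix.diagonal_zero, Matrix.fromBlocks_diagonal,
    Matrix.rank_diagonal, Fintype.card_subtype]
  have : (Finset.univ.filter fun i : Fin a ⊕ Fin b =>
      Sum.elim (fun _ => (1 : K)) (fun _ => 0) i ≠ 0)
      = Finset.univ.map Function.Embedding.inl := by
    ext (i | i) <;> simp
  rw [this]; simp

theorem rank_map_ringHom (f : K →+* L) (M : Matrix (Fin n) (Fin n) K) :
    (M.map f).rank = M.rank := by
  obtain ⟨V, U, e, hV, hU, h⟩ := M.exists_rank_normal_form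
  have hV' : IsUnit (V.map f).det := by
    rw [← RingHom.mapMatrix_apply, ← RingHom.map_det]
    exact ((Matrix.isUnit_iff_isUnit_det _).1 hV).map f
  have hU' : IsUnit (U.map f).det := by
    rw [← RingHom.mapMatrix_apply, ← RingHom.map_det]
    exact ((Matrix.isUnit_iff_isUnit_det _).1 hU).map f
  have h' := congrArg (fun N => N.map f) h
  simp only [Matrix.map_mul] at h'
  rw [← Matrix.rank_mul_eq_right_of_isUnit_det _ _ hV',
    ← Matrix.rank_mul_eq_left_of_isUnit_det _ (V.map f * M.map f) hU', h']
  have : (Matrix.fromBlocks (1 : Matrix (Fin M.rank) (Fin M.rank) K) 0 0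
      (0 : Matrix (Fin (Fintype.card (Fin n) - M.rank))
        (Fin (Fintype.card (Fin n) - M.rank)) K)).map
        f = Matrix.fromBlocks 1 0 0 0 := by
    rw [Matrix.fromBlocks_map]; simp
  rw [← Matrix.submatrix_map, this, Matrix.rank_submatrix, rank_fromBlocks_one]

end RankMap

section Inversion

variable {F : Type*} [Field F] {n : ℕ}

theorem map_pencilOf (P₀ P₁ : Matrix (Fin n) (Fin n) F) :
    (pencilOf P₀ P₁).map (algebraMap F[X] (RatFunc F)) =
      P₀.map (algebraMap F (RatFunc F)) + (RatFunc.X : RatFunc F) • P₁.map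
        (algebraMap F (RatFunc F)) := by
  ext i j
  simp only [pencilOf, Matrix.map_apply, Matrix.add_apply, Matrix.smul_apply, smul_eq_mul,
    map_add, map_mul, RatFunc.algebraMap_C, RatFunc.algebraMap_X, RatFunc.algebraMap_eq_C]

theorem normalRank_pencilOf_invert (P₀ P₁ : Matrix (Fin n) (Fin n) F) (c : F) :
    normalRank (pencilOf P₁ (P₀ + c • P₁)) = normalRank (pencilOf P₀ P₁) := by
  have htr : Transcendental F ((RatFunc.X : RatFunc F)⁻¹ + algebraMap F (RatFunc F) c) := by
    intro h
    have h1 := (h.sub (isAlgebraic_algebraMap c)).inv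
    simp only [add_sub_cancel_right, inv_inv] at h1
    exact RatFunc.transcendental_X h1
  let τ : RatFunc F →ₐ[F] RatFunc F :=
    (IntermediateField.val _).comp (RatFunc.algEquivOfTranscendental _ htr).toAlgHom
  have hτ : τ RatFunc.X = (RatFunc.X : RatFunc F)⁻¹ + algebraMap F (RatFunc F) c := by
    rw [← RatFunc.algebraMap_X]
    change ((RatFunc.algEquivOfTranscendental _ htr (algebraMap F[X] (RatFunc F) X) :) :
      RatFunc F) = _
    rw [RatFunc.algEquivOfTranscendental_algebraMap, aeval_X,
      IntermediateField.AdjoinSimple.coe_gen, RatFunc.algebraMap_X]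
  have hC (a : F) : τ (RatFunc.C a) = RatFunc.C a := by
    simpa only [RatFunc.algebraMap_eq_C] using τ.commutes a
  have hX : (RatFunc.X : RatFunc F) ≠ 0 := RatFunc.X_ne_zero
  rw [normalRank, normalRank, ← rank_map_ringHom (τ : RatFunc F →+* RatFunc F)
    ((pencilOf P₀ P₁).map _), ← Matrix.rank_smul_of_mem_nonZeroDivisors
    (((pencilOf P₀ P₁).map _).map _) (mem_nonZeroDivisors_of_ne_zero hX),
    map_pencilOf, map_pencilOf]
  congr 1
  ext i j
  simp [hτ, hC]
  field_simp
  ring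

/-- The ring automorphism `s ↦ t + c s`, `t ↦ s`. -/
noncomputable def invertEquiv (c : F) :
    MvPolynomial (Fin 2) F ≃ₐ[F] MvPolynomial (Fin 2) F :=
  AlgEquiv.ofAlgHom
    (MvPolynomial.aeval ![MvPolynomial.X 1 + MvPolynomial.C c * MvPolynomial.X 0, MvPolynomial.X 0])
    (MvPolynomial.aeval ![MvPolynomial.X 1, MvPolynomial.X 0 - MvPolynomial.C c * MvPolynomial.X 1])
    (by ext i : 1; fin_cases i <;> simp [MvPolynomial.algHom_C])
    (by ext i : 1; fin_cases i <;> simp [MvPolynomial.algHom_C])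


theorem IsGCDOf.map_equiv {R S : Type*} [CommRing R] [CommRing S] (e : R ≃+* S) {g : R} {T : Set R}
    (h : IsGCDOf g T) : IsGCDOf (e g) (Set.image e T) := by
  refine ⟨?_, fun d hd => ?_⟩
  · rintro _ ⟨x, hx, rfl⟩
    exact (map_dvd_iff e).2 (h.1 x hx)
  · obtain ⟨d, rfl⟩ := e.surjective d
    exact (map_dvd_iff e).2 (h.2 d fun x hx => (map_dvd_iff e).1 (hd _ ⟨x, hx, rfl⟩))

theorem map_homPencil_invertEquiv (G₀ G₁ : Matrix (Fin n) (Fin n) F) (c : F) :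
    (homPencil G₀ G₁).map (invertEquiv c) = homPencil G₁ (G₀ + c • G₁) := by
  ext1 i j
  simp [homPencil, invertEquiv, MvPolynomial.algHom_C]
  ring

theorem image_minorsSet {R S : Type*} [CommRing R] [CommRing S] (e : R →+* S)
    (M : Matrix (Fin n) (Fin n) R) (k : ℕ) :
    Set.image e (minorsSet M k) = minorsSet (M.map e) k := by
  ext x
  constructor
  · rintro ⟨_, ⟨ri, ci, h1, h2, rfl⟩, rfl⟩
    exact ⟨ri, ci, h1, h2, by rw [RingHom.map_det]; rfl⟩
  · rintro ⟨ri, ci, h1, h2, rfl⟩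
    exact ⟨_, ⟨ri, ci, h1, h2, rfl⟩, by rw [RingHom.map_det]; rfl⟩

theorem IsHomogeneousIF.invert {G₀ G₁ : Matrix (Fin n) (Fin n) F}
    {φ : ℕ → MvPolynomial (Fin 2) F} (h : IsHomogeneousIF G₀ G₁ φ) (c : F) :
    IsHomogeneousIF G₁ (G₀ + c • G₁) fun i => invertEquiv c (φ i) := by
  intro k hk
  have := (h k hk).map_equiv (invertEquiv c).toRingEquiv
  rw [← map_homPencil_invertEquiv]
  have h2 := image_minorsSet
    (invertEquiv c : MvPolynomial (Fin 2) F →ₐ[F] MvPolynomial (Fin 2) F).toRingHom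
    (homPencil G₀ G₁) k
  refine h2 ▸ ?_
  rw [← map_prod]
  exact this

theorem interlace_map_equiv {R S : Type*} [CommRing R] [CommRing S] (e : R ≃+* S) {r : ℕ}
    {φ ψ : ℕ → R} : Interlace n r (fun i => e (φ i)) (fun i => e (ψ i)) ↔ Interlace n r φ ψ := by
  simp only [interlace_iff, map_dvd_iff]

end Inversion

section NormalRank

theorem matrix_rank_add_le {K : Type*} [Field K] {n : ℕ} (M N : Matrix (Fin n) (Fin n) K) :
    (M + N).rank ≤ M.rank + N.rank := by
  rw [Matrix.rank, Matrix.rank, Matrix.rank, Matrix.mulVecLin_add]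
  refine le_trans (Submodule.finrank_mono ?_)
    (Submodule.finrank_add_le_finrank_add_finrank M.mulVecLin.range N.mulVecLin.range)
  rintro _ ⟨v, rfl⟩
  exact Submodule.add_mem_sup ⟨v, rfl⟩ ⟨v, rfl⟩

variable {F : Type*} [Field F] {n : ℕ} (M N : Matrix (Fin n) (Fin n) F[X])

theorem normalRank_add_le : normalRank (M + N) ≤ normalRank M + normalRank N := by
  rw [normalRank, Matrix.map_add _ (map_add _)]
  exact matrix_rank_add_le _ _

theorem normalRank_mul_le_left : normalRank (M * N) ≤ normalRank M := by
  rw [normalRank, Matrix.map_mul]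
  exact Matrix.rank_mul_le_left _ _

theorem normalRank_mul_le_right : normalRank (M * N) ≤ normalRank N := by
  rw [normalRank, Matrix.map_mul]
  exact Matrix.rank_mul_le_right _ _

theorem normalRank_neg : normalRank (-M) = normalRank M := by
  refine le_antisymm ?_ ?_
  · simpa using normalRank_mul_le_right (-1) M
  · simpa using normalRank_mul_le_right (-1) (-M)

theorem normalRank_diagonal_le {k : ℕ} (d : Fin n → F[X]) (hd : ∀ i : Fin n, k ≤ i → d i = 0) :
    normalRank (Matrix.diagonal d) ≤ k := by
  classical
  rw [normalRank, Matrix.diagonal_map (map_zero _), Matrix.rank_diagonal]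
  have h : ∀ i : {i // algebraMap F[X] (RatFunc F) (d i) ≠ 0}, (i : ℕ) < k := fun i => by
    by_contra! h
    exact i.2 (by rw [hd _ h, map_zero])
  simpa using Fintype.card_le_of_injective
    (fun i : {i // algebraMap F[X] (RatFunc F) (d i) ≠ 0} => (⟨i, h i⟩ : Fin k))
    (fun a b hab => Subtype.ext (Fin.ext (by simpa using hab)))

theorem det_submatrix_eq_zero_of_normalRank_lt {k : ℕ} {M : Matrix (Fin n) (Fin n) F[X]}
    (h : normalRank M < k) (ri ci : Fin k → Fin n) : (M.submatrix ri ci).det = 0 := by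
  by_contra h0
  have h1 : ((M.map (algebraMap F[X] (RatFunc F))).submatrix ri ci).rank = k := by
    have := Matrix.rank_of_det_ne_zero
      (A := (M.map (algebraMap F[X] (RatFunc F))).submatrix ri ci) ?_
    · simpa using this
    · rw [Matrix.submatrix_map, ← RingHom.mapMatrix_apply, ← RingHom.map_det]
      simpa using h0
  have := Matrix.rank_submatrix_le (M.map (algebraMap F[X] (RatFunc F))) ri ci
  rw [h1] at this
  exact absurd this (not_le.2 h)

end NormalRank

section Necessity

theorem dvd_det_smul_one_add_sub_pow {R : Type*} [CommRing R] {k : ℕ} (a b : R)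
    (Z : Matrix (Fin k) (Fin k) R) : a ∣ (b • 1 + a • Z).det - b ^ k := by
  rw [← Ideal.mem_span_singleton, ← Ideal.Quotient.mk_eq_mk_iff_sub_mem, RingHom.map_det]
  have : (Ideal.Quotient.mk (Ideal.span {a})).mapMatrix (b • 1 + a • Z) =
      Ideal.Quotient.mk (Ideal.span {a}) b • 1 := by
    have ha : Ideal.Quotient.mk (Ideal.span {a}) a = 0 :=
      Ideal.Quotient.eq_zero_iff_mem.2 (Ideal.mem_span_singleton_self a)
    ext i j
    by_cases h : i = j <;> simp [ha, h]
  rw [this, Matrix.det_smul, Matrix.det_one, Fintype.card_fin, mul_one, map_pow]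

variable {F : Type*} [Field F] {n r : ℕ} {M N : Matrix (Fin n) (Fin n) F[X]} {α β : ℕ → F[X]}

theorem dvd_of_normalRank_sub_le (hα : ∀ i, α i ∣ α (i + 1)) (hβ : ∀ i, β i ∣ β (i + 1))
    (hβm : ∀ i < n, (β i).Monic)
    (hM : UEquiv M (Matrix.diagonal fun i : Fin n => α i))
    (hN : UEquiv N (Matrix.diagonal fun i : Fin n => β i))
    (hr : normalRank (N - M) ≤ r) {k : ℕ} (hk : k + r < n) : α k ∣ β (k + r) := by
  classical
  obtain ⟨U, V, -, -, hM⟩ := hM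
  obtain ⟨S, T, -, -, hN⟩ := hN.symm
  choose! γ hγ using fun i (hi : k ≤ i) => dvd_of_le_of_chain hα hi
  choose! μ hμ using fun i (hi : i ≤ k + r) => dvd_of_le_of_chain hβ hi
  have hsplit : (Matrix.diagonal fun i : Fin n => α i) =
      (Matrix.diagonal fun i : Fin n => if (i : ℕ) < k then α i else 0) +
        α k • (Matrix.diagonal fun i : Fin n => if (i : ℕ) < k then 0 else γ i) := by
    rw [← Matrix.diagonal_smul, Matrix.diagonal_add]
    congr 1
    ext1 i
    by_cases h : (i : ℕ) < k
    · simp [h]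
    · simp [h, ← hγ i (by omega)]
  set X₀ := U * (Matrix.diagonal fun i : Fin n => if (i : ℕ) < k then α i else 0) * V with hX₀
  set Z₀ := U * (Matrix.diagonal fun i : Fin n => if (i : ℕ) < k then 0 else γ i) * V with hZ₀
  have hMX : M = X₀ + α k • Z₀ := by
    rw [hM, hsplit, Matrix.mul_add, Matrix.add_mul, hX₀, hZ₀]
    simp
  set Y := S * (X₀ + (N - M)) * T with hY
  set Z := S * Z₀ * T with hZ
  have hYβ : (Matrix.diagonal fun i : Fin n => β i) = Y + α k • Z := by
    have : N = X₀ + (N - M) + α k • Z₀ := by rw [hMX]; abel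
    conv_lhs => rw [hN, this]
    rw [Matrix.mul_add, Matrix.add_mul, hY, hZ]
    simp
  have hYr : normalRank Y < k + r + 1 := by
    refine Nat.lt_succ_of_le ((normalRank_mul_le_left _ _).trans
      ((normalRank_mul_le_right _ _).trans ((normalRank_add_le _ _).trans (add_le_add ?_ hr))))
    refine (normalRank_mul_le_left _ _).trans ((normalRank_mul_le_right _ _).trans
      (normalRank_diagonal_le _ fun i hi => ?_))
    simp [not_lt.2 hi]
  set ι : Fin (k + r + 1) → Fin n := Fin.castLE hk with hι
  have hdet := det_submatrix_eq_zero_of_normalRank_lt hYr ι ι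
  have hβ0 : β (k + r) ≠ 0 := (hβm _ hk).ne_zero
  obtain ⟨a, ha⟩ := EuclideanDomain.gcd_dvd_left (α k) (β (k + r))
  obtain ⟨b, hb⟩ := EuclideanDomain.gcd_dvd_right (α k) (β (k + r))
  have hg0 : EuclideanDomain.gcd (α k) (β (k + r)) ≠ 0 := fun h => hβ0 (by rw [hb, h, zero_mul])
  have hbez := EuclideanDomain.gcd_eq_gcd_ab (α k) (β (k + r))
  generalize EuclideanDomain.gcd (α k) (β (k + r)) = g at ha hb hg0 hbez
  have hcop : IsCoprime a b := by
    refine ⟨EuclideanDomain.gcdA (α k) (β (k + r)), EuclideanDomain.gcdB (α k) (β (k + r)),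
      mul_left_cancel₀ hg0 ?_⟩
    rw [mul_one]
    conv_rhs => rw [hbez]
    generalize EuclideanDomain.gcdA (α k) (β (k + r)) = x
    generalize EuclideanDomain.gcdB (α k) (β (k + r)) = y
    rw [ha, hb]
    ring
  have hkey : (Matrix.diagonal fun i : Fin (k + r + 1) => μ i) * Y.submatrix ι ι = g •
      (b • (1 : Matrix (Fin (k + r + 1)) (Fin (k + r + 1)) F[X]) + a •
        -((Matrix.diagonal fun i : Fin (k + r + 1) => μ i) * Z.submatrix ι ι)) := by
    have h1 := congrArg (fun W => (Matrix.diagonal fun i : Fin (k + r + 1) => μ i) *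
      Matrix.submatrix W ι ι) hYβ
    ext1 i j
    have h2 := congrFun (congrFun h1 i) j
    simp only [Matrix.diagonal_mul, Matrix.submatrix_apply, Matrix.add_apply, Matrix.smul_apply,
      smul_eq_mul, Matrix.neg_apply, ha] at h2 ⊢
    have h3 : μ i * (Matrix.diagonal fun i : Fin n => β i) (ι i) (ι j) =
        β (k + r) * (1 : Matrix (Fin (k + r + 1)) (Fin (k + r + 1)) F[X]) i j := by
      by_cases hij : i = j
      · subst hij
        simp only [Matrix.diagonal_apply_eq, Matrix.one_apply_eq, mul_one]
        rw [hμ i (Nat.lt_succ_iff.1 i.2), mul_comm]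
        rfl
      · rw [Matrix.diagonal_apply_ne _ (fun h => hij (Fin.castLE_injective _ h)),
          Matrix.one_apply_ne hij, mul_zero, mul_zero]
    rw [h3, hb] at h2
    linear_combination -h2
  have hz := congrArg Matrix.det hkey
  rw [Matrix.det_mul, hdet, mul_zero, Matrix.det_smul] at hz
  have hz' := (mul_eq_zero.1 hz.symm).resolve_left (pow_ne_zero _ hg0)
  have hdvd := dvd_det_smul_one_add_sub_pow a b
    (-((Matrix.diagonal fun i : Fin (k + r + 1) => μ i) * Z.submatrix ι ι))
  rw [hz', zero_sub, dvd_neg] at hdvd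
  have hu : IsUnit a := hcop.pow_right.isUnit_of_dvd' dvd_rfl hdvd
  obtain ⟨u, rfl⟩ := hu
  rw [ha, hb]
  exact mul_dvd_mul_left _ (Units.coe_dvd)

end Necessity

section Realization
variable {F : Type*} [Field F] {n : ℕ}

/-- The matrix `a` describes multiplication by `X` on the cokernel of `D`. -/
def Realizes (D : Matrix (Fin n) (Fin n) F[X]) (a : Matrix (Fin n) (Fin n) F) : Prop :=
  ∃ π : (Fin n → F[X]) →ₗ[F] (Fin n → F), Function.Surjective π ∧
    (∀ v, π v = 0 ↔ ∃ u, v = D.mulVec u) ∧ ∀ v, π ((X : F[X]) • v) = a.mulVec (π v)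

theorem exists_equiv_of_ker_eq {V W : Type*} [AddCommGroup V] [Module F V] [AddCommGroup W]
    [Module F W] (π₁ π₂ : V →ₗ[F] W) (h₁ : Function.Surjective π₁) (h₂ : Function.Surjective π₂)
    (h : ∀ v, π₁ v = 0 ↔ π₂ v = 0) : ∃ e : W ≃ₗ[F] W, ∀ v, e (π₁ v) = π₂ v := by
  have hk : LinearMap.ker π₁ = LinearMap.ker π₂ := by ext v; simpa using h v
  refine ⟨(π₁.quotKerEquivOfSurjective h₁).symm ≪≫ₗ Submodule.quotEquivOfEq _ _ hk ≪≫ₗ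
    π₂.quotKerEquivOfSurjective h₂, fun v => ?_⟩
  have : (π₁.quotKerEquivOfSurjective h₁).symm (π₁ v) = Submodule.Quotient.mk v := by
    rw [LinearEquiv.symm_apply_eq]; rfl
  simp only [LinearEquiv.trans_apply, this]
  rfl

theorem Realizes.exists_conj {D : Matrix (Fin n) (Fin n) F[X]} {a b : Matrix (Fin n) (Fin n) F}
    (ha : Realizes D a) (hb : Realizes D b) :
    ∃ g : Matrix (Fin n) (Fin n) F, IsUnit g.det ∧ b * g = g * a := by
  obtain ⟨π₁, s₁, k₁, x₁⟩ := ha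
  obtain ⟨π₂, s₂, k₂, x₂⟩ := hb
  obtain ⟨e, he⟩ := exists_equiv_of_ker_eq π₁ π₂ s₁ s₂ fun v => (k₁ v).trans (k₂ v).symm
  refine ⟨LinearMap.toMatrix' e.toLinearMap, ?_, ?_⟩
  · rw [LinearMap.det_toMatrix']; exact e.isUnit_det'
  · apply Matrix.toLin'.injective
    refine LinearMap.ext fun w => ?_
    obtain ⟨v, rfl⟩ := s₁ w
    simp only [Matrix.toLin'_mul, Matrix.toLin'_toMatrix', LinearMap.comp_apply,
      LinearEquiv.coe_coe, he, Matrix.toLin'_apply, ← x₁, ← x₂]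

theorem Realizes.conj {D : Matrix (Fin n) (Fin n) F[X]} {a g : Matrix (Fin n) (Fin n) F}
    (ha : Realizes D a) (hg : IsUnit g.det) : Realizes D (g * a * g⁻¹) := by
  obtain ⟨π, s, k, x⟩ := ha
  refine ⟨(Matrix.mulVecLin g).comp π, ?_, fun v => ?_, fun v => ?_⟩
  · refine Function.Surjective.comp (g := Matrix.mulVecLin g) (fun w => ⟨g⁻¹.mulVec w, ?_⟩) s
    simp [Matrix.mulVec_mulVec, Matrix.mul_nonsing_inv g hg]
  · rw [← k]
    refine ⟨fun h => ?_, fun h => by simp [h]⟩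
    have := congrArg (g⁻¹.mulVec) h
    simpa [Matrix.mulVec_mulVec, Matrix.nonsing_inv_mul g hg] using this
  · simp [Matrix.mulVec_mulVec, x, Matrix.mul_assoc, Matrix.nonsing_inv_mul g hg]

theorem Realizes.of_uEquiv {D D' : Matrix (Fin n) (Fin n) F[X]} {a : Matrix (Fin n) (Fin n) F}
    (ha : Realizes D' a) (h : UEquiv D D') : Realizes D a := by
  obtain ⟨U, V, hU, hV, rfl⟩ := h
  obtain ⟨π, s, k, x⟩ := ha
  refine ⟨π.comp ((Matrix.mulVecLin U⁻¹).restrictScalars F), ?_, fun v => ?_, fun v => ?_⟩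
  · refine s.comp (g := π) (f := (Matrix.mulVecLin U⁻¹).restrictScalars F) fun w => ⟨U.mulVec w, ?_⟩
    simp [Matrix.mulVec_mulVec, Matrix.nonsing_inv_mul U hU]
  · simp only [LinearMap.comp_apply, LinearMap.restrictScalars_apply, Matrix.mulVecLin_apply, k]
    constructor
    · rintro ⟨u, hu⟩
      refine ⟨V⁻¹.mulVec u, ?_⟩
      have := congrArg U.mulVec hu
      rw [Matrix.mulVec_mulVec, Matrix.mul_nonsing_inv U hU, Matrix.one_mulVec] at this
      rw [this, Matrix.mulVec_mulVec, Matrix.mulVec_mulVec, Matrix.mul_assoc, Matrix.mul_assoc,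
        Matrix.mul_nonsing_inv V hV, Matrix.mul_one]
    · rintro ⟨u, rfl⟩
      refine ⟨V.mulVec u, ?_⟩
      rw [Matrix.mulVec_mulVec, Matrix.mulVec_mulVec, Matrix.mul_assoc U,
        Matrix.nonsing_inv_mul_cancel_left U _ hU]
  · simp [x]

theorem submodule_eq_top_of_smul_mem (S : Submodule F (Fin n → F[X]))
    (hX : ∀ v ∈ S, (X : F[X]) • v ∈ S) (h1 : ∀ i, Pi.single i 1 ∈ S) : S = ⊤ := by
  have hs : ∀ (p : F[X]) (v), v ∈ S → p • v ∈ S := by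
    intro p v hv
    induction p using Polynomial.induction_on' with
    | add p q hp hq => rw [add_smul]; exact S.add_mem hp hq
    | monomial k c =>
      rw [← C_mul_X_pow_eq_monomial, mul_smul]
      have : ∀ k : ℕ, (X : F[X]) ^ k • v ∈ S := by
        intro k
        induction k with
        | zero => simpa using hv
        | succ k ih => rw [pow_succ', mul_smul]; exact hX _ ih
      have h2 := S.smul_mem c (this k)
      convert h2 using 1
      ext i : 1
      simp [Polynomial.smul_eq_C_mul]
  refine eq_top_iff.2 fun v _ => ?_
  have : v = ∑ i, v i • (Pi.single i 1 : Fin n → F[X]) := by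
    ext j : 1
    simp [Finset.sum_apply, Pi.single_apply]
  rw [this]
  exact S.sum_mem fun i _ => hs _ _ (h1 i)

theorem Realizes.similar_of_linear {a A : Matrix (Fin n) (Fin n) F}
    (h : Realizes ((X : F[X]) • (1 : Matrix (Fin n) (Fin n) F[X]) - A.map C) a) :
    ∃ g : Matrix (Fin n) (Fin n) F, IsUnit g.det ∧ a * g = g * A := by
  obtain ⟨π, s, k, x⟩ := h
  let ι : (Fin n → F) →ₗ[F] (Fin n → F[X]) :=
    LinearMap.pi fun i => (Polynomial.monomial 0).comp (LinearMap.proj i)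
  have hι : ∀ w i, ι w i = C (w i) := fun w i => rfl
  have key : ∀ w, a.mulVec (π (ι w)) = π (ι (A.mulVec w)) := by
    intro w
    rw [← x, ← sub_eq_zero, ← map_sub, k]
    refine ⟨ι w, ?_⟩
    ext1 i
    simp only [Matrix.sub_mulVec, Matrix.smul_mulVec, Matrix.one_mulVec, Pi.sub_apply, hι]
    congr 1
    simp [Matrix.mulVec, dotProduct, hι]
  have hsurj : Function.Surjective (π.comp ι) := by
    have : (LinearMap.range (π.comp ι)).comap π = ⊤ := by
      refine submodule_eq_top_of_smul_mem _ ?_ ?_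
      · rintro v ⟨w, hw⟩
        refine ⟨A.mulVec w, ?_⟩
        rw [x, ← hw]
        exact (key w).symm
      · intro i
        refine ⟨Pi.single i 1, ?_⟩
        rw [LinearMap.comp_apply]
        congr 1
        ext1 j
        rw [hι]
        by_cases hj : j = i
        · subst hj; simp
        · simp [hj]
    intro w
    obtain ⟨v, rfl⟩ := s w
    have : v ∈ (LinearMap.range (π.comp ι)).comap π := this ▸ Submodule.mem_top
    exact this
  have hinj := LinearMap.injective_iff_surjective.2 hsurj
  refine ⟨LinearMap.toMatrix' (π.comp ι), ?_, ?_⟩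
  · rw [LinearMap.det_toMatrix']
    exact (LinearEquiv.ofBijective _ ⟨hinj, hsurj⟩).isUnit_det'
  · apply Matrix.toLin'.injective
    refine LinearMap.ext fun w => ?_
    simpa only [Matrix.toLin'_mul, Matrix.toLin'_toMatrix', LinearMap.comp_apply,
      Matrix.toLin'_apply] using key w

end Realization

section ColReduced
variable {F : Type*} [Field F] {n : ℕ}

/-- The diagonal entries are monic of degrees `d i`, and dominate their rows. -/
def RowReduced (d : Fin n → ℕ) (D : Matrix (Fin n) (Fin n) F[X]) : Prop :=
  (∀ i, (D i i).Monic ∧ (D i i).natDegree = d i) ∧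
    ∀ i j, i ≠ j → ∀ m, d i ≤ m → (D i j).coeff m = 0

/-- Vectors of polynomials with `i`-th entry of degree less than `d i`. -/
noncomputable def degreeLTPi (F : Type*) [Field F] {n : ℕ} (d : Fin n → ℕ) :
    Submodule F (Fin n → F[X]) :=
  Submodule.pi Set.univ fun i => degreeLT F (d i)

theorem mem_degreeLTPi {d : Fin n → ℕ} {w : Fin n → F[X]} :
    w ∈ degreeLTPi F d ↔ ∀ i m, d i ≤ m → (w i).coeff m = 0 := by
  simp [degreeLTPi, Submodule.mem_pi, mem_degreeLT, degree_lt_iff_coeff_zero]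

theorem exists_equiv_degreeLTPi {d : Fin n → ℕ} (hd : ∑ i, d i = n) :
    Nonempty (degreeLTPi F d ≃ₗ[F] (Fin n → F)) := by
  let e : degreeLTPi F d ≃ₗ[F] ((i : Fin n) → degreeLT F (d i)) :=
    { toFun := fun w i => ⟨w.1 i, w.2 i trivial⟩
      invFun := fun w => ⟨fun i => (w i).1, fun i _ => (w i).2⟩
      map_add' := fun _ _ => rfl
      map_smul' := fun _ _ => rfl
      left_inv := fun _ => rfl
      right_inv := fun _ => rfl }
  have : ∀ i, Module.Finite F (degreeLT F (d i)) := fun i =>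
    Module.Finite.equiv (degreeLTEquiv F (d i)).symm
  refine ⟨e ≪≫ₗ LinearEquiv.ofFinrankEq _ _ ?_⟩
  rw [Module.finrank_pi_fintype]
  simp [(degreeLTEquiv F _).finrank_eq, hd]

/-- The coefficient of degree `d i` of `X * v i`. -/
noncomputable def overflow (d : Fin n → ℕ) (i : Fin n) : (Fin n → F[X]) →ₗ[F] F where
  toFun v := (X * v i).coeff (d i)
  map_add' v w := by simp [mul_add]
  map_smul' c v := by simp

/-- Multiplication by `X`, reduced by the columns of `D`. -/
noncomputable def reduceX (d : Fin n → ℕ) (D : Matrix (Fin n) (Fin n) F[X]) :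
    (Fin n → F[X]) →ₗ[F] (Fin n → F[X]) where
  toFun v := (X : F[X]) • v - D.mulVec fun j => C (overflow d j v)
  map_add' v w := by
    have : (fun j => C (overflow d j (v + w))) =
        (fun j => C (overflow d j v)) + fun j => C (overflow d j w) := by ext1 j; simp
    rw [this, Matrix.mulVec_add, smul_add]; abel
  map_smul' c v := by
    have : (fun j => C (overflow d j (c • v))) = c • fun j => C (overflow d j v) := by
      ext1 j; simp [Polynomial.smul_eq_C_mul]
    rw [this, Matrix.mulVec_smul, smul_sub, smul_comm]; rfl

theorem reduceX_apply (d : Fin n → ℕ) (D : Matrix (Fin n) (Fin n) F[X]) (v) :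
    reduceX d D v = (X : F[X]) • v - D.mulVec fun j => C (overflow d j v) := rfl

variable {d : Fin n → ℕ} {D D' : Matrix (Fin n) (Fin n) F[X]}

theorem RowReduced.reduceX_mem (hD : RowReduced d D) {w : Fin n → F[X]} (hw : w ∈ degreeLTPi F d) :
    reduceX d D w ∈ degreeLTPi F d := by
  rw [mem_degreeLTPi] at hw ⊢
  intro i m hm
  have h1 : ∀ j, (D i j * C (overflow d j w)).coeff m =
      if j = i then (if m = d i then overflow d i w else 0) else 0 := by
    intro j
    rw [coeff_mul_C]
    by_cases hj : j = i
    · subst hj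
      rw [if_pos rfl]
      obtain ⟨h1, h2⟩ := hD.1 j
      by_cases hmd : m = d j
      · rw [if_pos hmd, hmd, ← h2, h1.coeff_natDegree, one_mul]
      · rw [if_neg hmd, coeff_eq_zero_of_natDegree_lt (by omega), zero_mul]
    · rw [if_neg hj, hD.2 i j (Ne.symm hj) m hm, zero_mul]
  have h2 : (D.mulVec (fun j => C (overflow d j w)) i).coeff m =
      if m = d i then overflow d i w else 0 := by
    simp only [Matrix.mulVec, dotProduct, finsetSum_coeff, h1]
    simp
  rw [reduceX_apply, Pi.sub_apply, coeff_sub, h2, Pi.smul_apply, smul_eq_mul]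
  split_ifs with h
  · rw [h]; exact sub_self _
  · obtain ⟨k, rfl⟩ : ∃ k, m = k + 1 := ⟨m - 1, by omega⟩
    rw [coeff_X_mul, hw i k (by omega), sub_zero]

theorem RowReduced.eq_zero_of_mulVec_mem (hD : RowReduced d D) {u : Fin n → F[X]}
    (hu : D.mulVec u ∈ degreeLTPi F d) : u = 0 := by
  by_contra hne
  obtain ⟨i₀, hi₀⟩ : ∃ i, u i ≠ 0 := by
    by_contra! h; exact hne (funext h)
  obtain ⟨i, -, hi⟩ := Finset.exists_max_image Finset.univ (fun i => (u i).degree) ⟨i₀, by simp⟩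
  have hui : u i ≠ 0 := fun h => hi₀ (by simpa [h] using hi i₀ (by simp))
  rw [mem_degreeLTPi] at hu
  have := hu i (d i + (u i).natDegree) (by omega)
  simp only [Matrix.mulVec, dotProduct, finsetSum_coeff] at this
  rw [Finset.sum_eq_single i] at this
  · rw [← (hD.1 i).2, coeff_mul_degree_add_degree, (hD.1 i).1.leadingCoeff, one_mul] at this
    exact hui (leadingCoeff_eq_zero.1 this)
  · intro j _ hj
    by_cases hz : D i j = 0
    · simp [hz]
    refine coeff_eq_zero_of_natDegree_lt (natDegree_mul_le.trans_lt ?_)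
    have h1 : (D i j).natDegree < d i := by
      by_contra! h
      exact hz (leadingCoeff_eq_zero.1 (hD.2 i j (Ne.symm hj) _ h))
    have h2 : (u j).natDegree ≤ (u i).natDegree := natDegree_le_natDegree (hi j (by simp))
    omega
  · simp

/-- The column span of `D`. -/
noncomputable def colSpan (D : Matrix (Fin n) (Fin n) F[X]) : Submodule F (Fin n → F[X]) :=
  LinearMap.range (D.mulVecLin.restrictScalars F)

theorem mem_colSpan {v : Fin n → F[X]} : v ∈ colSpan D ↔ ∃ u, v = D.mulVec u := by
  simp [colSpan, eq_comm]

theorem smul_mem_colSpan (p : F[X]) {v : Fin n → F[X]} (hv : v ∈ colSpan D) :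
    p • v ∈ colSpan D := by
  rw [mem_colSpan] at hv ⊢
  obtain ⟨u, rfl⟩ := hv
  exact ⟨p • u, (Matrix.mulVec_smul _ _ _).symm⟩

theorem RowReduced.isCompl (hD : RowReduced d D) : IsCompl (degreeLTPi F d) (colSpan D) := by
  constructor
  · rw [Submodule.disjoint_def]
    intro x hx hx'
    obtain ⟨u, rfl⟩ := mem_colSpan.1 hx'
    rw [hD.eq_zero_of_mulVec_mem hx, Matrix.mulVec_zero]
  · rw [codisjoint_iff]
    refine submodule_eq_top_of_smul_mem _ ?_ ?_
    · intro v hv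
      obtain ⟨w, hw, c, hc, rfl⟩ := Submodule.mem_sup.1 hv
      have : (X : F[X]) • (w + c) = reduceX d D w +
          (D.mulVec (fun j => C (overflow d j w)) + (X : F[X]) • c) := by
        rw [reduceX_apply, smul_add]; abel
      rw [this]
      exact Submodule.add_mem_sup (hD.reduceX_mem hw)
        (add_mem (mem_colSpan.2 ⟨_, rfl⟩) (smul_mem_colSpan _ hc))
    · intro i
      by_cases hi : d i = 0
      · have : (Pi.single i 1 : Fin n → F[X]) = (Pi.single i 1 - D.mulVec (Pi.single i 1)) +
            D.mulVec (Pi.single i 1) := by abel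
        rw [this]
        refine Submodule.add_mem_sup ?_ (mem_colSpan.2 ⟨_, rfl⟩)
        rw [mem_degreeLTPi]
        intro j m hm
        rw [Matrix.mulVec_single_one, Pi.sub_apply]
        by_cases hj : j = i
        · subst hj
          have : D j j = 1 := (hD.1 j).1.natDegree_eq_zero.1 ((hD.1 j).2.trans hi)
          simp [Matrix.col, this]
        · simp [hj, Matrix.col, hD.2 j i hj m hm]
      · refine Submodule.mem_sup_left (mem_degreeLTPi.2 fun j m hm => ?_)
        by_cases hj : j = i
        · subst hj
          rw [Pi.single_eq_same, coeff_one, if_neg (by omega)]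
        · simp [hj]

/-- Multiplication by `X` on the representatives of bounded degree, in coordinates. -/
noncomputable def reducedMatrix (e : degreeLTPi F d ≃ₗ[F] (Fin n → F)) (hD : RowReduced d D) :
    Matrix (Fin n) (Fin n) F :=
  LinearMap.toMatrix' (e.toLinearMap ∘ₗ
    ((reduceX d D).restrict fun _ hw => hD.reduceX_mem hw) ∘ₗ e.symm.toLinearMap)

theorem reducedMatrix_mulVec (e : degreeLTPi F d ≃ₗ[F] (Fin n → F)) (hD : RowReduced d D)
    (w : degreeLTPi F d) :
    (reducedMatrix e hD).mulVec (e w) = e ⟨reduceX d D w, hD.reduceX_mem w.2⟩ := by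
  rw [reducedMatrix, ← Matrix.toLin'_apply, Matrix.toLin'_toMatrix']
  simp
  rfl

theorem realizes_reducedMatrix (e : degreeLTPi F d ≃ₗ[F] (Fin n → F)) (hD : RowReduced d D) :
    Realizes D (reducedMatrix e hD) := by
  have h := hD.isCompl
  refine ⟨e.toLinearMap ∘ₗ Submodule.projectionOnto _ _ h, ?_, fun v => ?_, fun v => ?_⟩
  · exact e.surjective.comp (fun w => ⟨w, Submodule.projectionOnto_apply_left h w⟩)
  · simp only [LinearMap.comp_apply, LinearEquiv.coe_coe, map_eq_zero_iff e e.injective,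
      Submodule.projectionOnto_apply_eq_zero_iff]
    exact mem_colSpan
  · obtain ⟨w, hw, c, hc, rfl⟩ := Submodule.mem_sup.1
      (h.sup_eq_top.symm ▸ Submodule.mem_top : v ∈ degreeLTPi F d ⊔ colSpan D)
    have h0 : ∀ c ∈ colSpan D, Submodule.projectionOnto _ _ h c = 0 := fun c hc =>
      (Submodule.projectionOnto_apply_eq_zero_iff h).2 hc
    have h1 : (X : F[X]) • (w + c) = reduceX d D w +
        (D.mulVec (fun j => C (overflow d j w)) + (X : F[X]) • c) := by
      rw [reduceX_apply, smul_add]; abel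
    have h2 := h0 _ (add_mem (mem_colSpan.2 ⟨fun j => C (overflow d j w), rfl⟩)
      (smul_mem_colSpan X hc))
    have h3 := Submodule.projectionOnto_apply_left h ⟨w, hw⟩
    have h4 := Submodule.projectionOnto_apply_left h ⟨reduceX d D w, hD.reduceX_mem hw⟩
    simp only [LinearMap.comp_apply, LinearEquiv.coe_coe]
    rw [h1, map_add, h2, add_zero, map_add, h0 c hc, add_zero, h3, h4, reducedMatrix_mulVec]

theorem rank_le_one_of_mulVec {a : Matrix (Fin n) (Fin n) F} {z : Fin n → F}
    (h : ∀ x, ∃ c : F, a.mulVec x = c • z) : a.rank ≤ 1 := by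
  rw [Matrix.rank]
  refine (Submodule.finrank_mono (t := Submodule.span F {z}) ?_).trans
    ((finrank_span_le_card _).trans (by simp))
  rintro _ ⟨x, rfl⟩
  obtain ⟨c, hc⟩ := h x
  rw [Matrix.mulVecLin_apply, hc]
  exact Submodule.smul_mem _ _ (Submodule.mem_span_singleton_self z)

theorem rank_reducedMatrix_sub_le_one (e : degreeLTPi F d ≃ₗ[F] (Fin n → F)) (hD : RowReduced d D)
    (hD' : RowReduced d D') (j₀ : Fin n) (h : ∀ i j, j ≠ j₀ → D i j = D' i j) :
    (reducedMatrix e hD - reducedMatrix e hD').rank ≤ 1 := by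
  have hz : (fun i => D' i j₀ - D i j₀) ∈ degreeLTPi F d := by
    rw [mem_degreeLTPi]
    intro i m hm
    rw [coeff_sub, sub_eq_zero]
    by_cases hi : i = j₀
    · subst hi
      obtain ⟨h1, h2⟩ := hD.1 i
      obtain ⟨h3, h4⟩ := hD'.1 i
      rcases hm.eq_or_lt with rfl | hm
      · nth_rw 1 [← h4]; rw [h3.coeff_natDegree, ← h2, h1.coeff_natDegree]
      · rw [coeff_eq_zero_of_natDegree_lt (by omega), coeff_eq_zero_of_natDegree_lt (by omega)]
    · rw [hD.2 i j₀ hi m hm, hD'.2 i j₀ hi m hm]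
  refine rank_le_one_of_mulVec (z := e ⟨_, hz⟩) fun x => ?_
  obtain ⟨w, rfl⟩ := e.surjective x
  refine ⟨overflow d j₀ w, ?_⟩
  rw [Matrix.sub_mulVec, reducedMatrix_mulVec, reducedMatrix_mulVec, ← map_sub, ← map_smul]
  congr 1
  ext i : 2
  simp only [reduceX_apply, AddSubgroupClass.coe_sub, Submodule.coe_smul, Pi.sub_apply,
    Pi.smul_apply, sub_sub_sub_cancel_left, Matrix.mulVec, dotProduct, ← Finset.sum_sub_distrib]
  rw [Finset.sum_eq_single j₀]
  · rw [Polynomial.smul_eq_C_mul]; ring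
  · intro j _ hj
    rw [h i j hj, sub_self]
  · simp

theorem RowReduced.exists_realizes_rank_sub_le_one (hd : ∑ i, d i = n) (hD : RowReduced d D)
    (hD' : RowReduced d D') (j₀ : Fin n) (h : ∀ i j, j ≠ j₀ → D i j = D' i j) :
    ∃ a b, Realizes D a ∧ Realizes D' b ∧ (a - b).rank ≤ 1 := by
  obtain ⟨e⟩ := exists_equiv_degreeLTPi (F := F) hd
  exact ⟨_, _, realizes_reducedMatrix e hD, realizes_reducedMatrix e hD',
    rank_reducedMatrix_sub_le_one e hD hD' j₀ h⟩

theorem RowReduced.exists_realizes (hd : ∑ i, d i = n) (hD : RowReduced d D) :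
    ∃ a, Realizes D a := by
  obtain ⟨e⟩ := exists_equiv_degreeLTPi (F := F) hd
  exact ⟨_, realizes_reducedMatrix e hD⟩

theorem rowReduced_diagonal {α : Fin n → F[X]} (h : ∀ i, (α i).Monic) :
    RowReduced (fun i => (α i).natDegree) (Matrix.diagonal α) :=
  ⟨fun i => by simp [h i], fun i j hij m _ => by simp [hij]⟩

end ColReduced

section Stairs
variable {R : Type*} [CommRing R]

/-- The matrix with first column `f` and `ε j` in position `(j, j + 1)`. -/
def stairs (m : ℕ) (f ε : ℕ → R) : Matrix (Fin (m + 1)) (Fin (m + 1)) R :=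
  Matrix.of fun i j => Fin.cases (f i) (fun j' => if i = j'.castSucc then ε j' else 0) j

theorem stairs_zero (m : ℕ) (f ε : ℕ → R) (i : Fin (m + 1)) : stairs m f ε i 0 = f i := rfl

theorem stairs_succ (m : ℕ) (f ε : ℕ → R) (i : Fin (m + 1)) (j : Fin m) :
    stairs m f ε i j.succ = if i = j.castSucc then ε j else 0 := rfl

theorem lowerBorder_mul_zero {n : ℕ} (c : Fin n → R) (M : Matrix (Fin (n + 1)) (Fin (n + 1)) R)
    (j) :
    (lowerBorder c * M) 0 j = M 0 j := by
  rw [Matrix.mul_apply, Fin.sum_univ_succ]; simp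

theorem lowerBorder_mul_succ {n : ℕ} (c : Fin n → R) (M : Matrix (Fin (n + 1)) (Fin (n + 1)) R)
    (i : Fin n) (j) : (lowerBorder c * M) i.succ j = c i * M 0 j + M i.succ j := by
  rw [Matrix.mul_apply, Fin.sum_univ_succ]; simp [Matrix.one_apply]

theorem mul_lowerBorder_zero {n : ℕ} (c : Fin n → R) (M : Matrix (Fin (n + 1)) (Fin (n + 1)) R)
    (i) :
    (M * lowerBorder c) i 0 = M i 0 + ∑ j, M i j.succ * c j := by
  rw [Matrix.mul_apply, Fin.sum_univ_succ]; simp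

theorem mul_lowerBorder_succ {n : ℕ} (c : Fin n → R) (M : Matrix (Fin (n + 1)) (Fin (n + 1)) R)
    (i) (j : Fin n) : (M * lowerBorder c) i j.succ = M i j.succ := by
  rw [Matrix.mul_apply, Fin.sum_univ_succ]; simp [Matrix.one_apply]

theorem mul_lowerBorder_transpose_zero {n : ℕ} (c : Fin n → R)
    (M : Matrix (Fin (n + 1)) (Fin (n + 1)) R) (i) :
    (M * (lowerBorder c).transpose) i 0 = M i 0 := by
  rw [Matrix.mul_apply, Fin.sum_univ_succ]; simp

theorem mul_lowerBorder_transpose_succ {n : ℕ} (c : Fin n → R)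
    (M : Matrix (Fin (n + 1)) (Fin (n + 1)) R) (i) (j : Fin n) :
    (M * (lowerBorder c).transpose) i j.succ = M i 0 * c j + M i j.succ := by
  rw [Matrix.mul_apply, Fin.sum_univ_succ]; simp [Matrix.one_apply]

theorem uEquiv_stairs : ∀ (m : ℕ) (α ε q s : ℕ → R), (∀ i < m, α (i + 1) = ε i * q i) →
    (∀ i < m, ε i = α i * s i) →
    UEquiv (stairs m (fun i => α 0 * ∏ l ∈ Finset.range i, q l) ε)
      (Matrix.diagonal fun i : Fin (m + 1) => α i) := by
  intro m
  induction m with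
  | zero =>
    intro α ε q s _ _
    convert UEquiv.refl _
    ext i j
    fin_cases i; fin_cases j
    simp [stairs]
  | succ m ih =>
    intro α ε q s hα hε
    have ih' := ih (fun i => α (i + 1)) (fun i => ε (i + 1)) (fun i => q (i + 1))
      (fun i => s (i + 1)) (fun i hi => hα (i + 1) (by omega)) (fun i hi => hε (i + 1) (by omega))
    set H := stairs m (fun i => α (0 + 1) * ∏ l ∈ Finset.range i, q (l + 1)) fun i => ε (i + 1)
    set N : Matrix (Fin (m + 1)) (Fin (m + 1)) R :=
      Matrix.diagonal (Fin.cons (-1) fun _ => 1) with hN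
    have hdetN : IsUnit N.det := by
      rw [hN, Matrix.det_diagonal, Fin.prod_univ_succ]; simp
    have key : stairs (m + 1) (fun i => α 0 * ∏ l ∈ Finset.range i, q l) ε =
        lowerBorder (fun i : Fin (m + 1) => ∏ l ∈ Finset.range (i + 1), q l) *
          (bordered (α 0) (H * N) * (lowerBorder (Fin.cons (s 0) fun _ => 0)).transpose) := by
      ext i j
      induction i using Fin.cases with
      | zero =>
        rw [lowerBorder_mul_zero]
        induction j using Fin.cases with
        | zero => simp [mul_lowerBorder_transpose_zero, stairs_zero]
        | succ j =>
          rw [mul_lowerBorder_transpose_succ, stairs_succ]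
          induction j using Fin.cases with
          | zero => rw [bordered_zero_succ]; simp [hε 0 (by omega)]
          | succ j => rw [bordered_zero_succ]; simp [Fin.ext_iff]
      | succ i =>
        rw [lowerBorder_mul_succ]
        induction j using Fin.cases with
        | zero => simp [mul_lowerBorder_transpose_zero, stairs_zero, mul_comm]
        | succ j =>
          rw [mul_lowerBorder_transpose_succ, mul_lowerBorder_transpose_succ, stairs_succ, hN,
            bordered_succ_succ, Matrix.mul_diagonal]
          induction j using Fin.cases with
          | zero =>
            simp only [H, stairs_zero, Fin.cons_zero]
            rw [bordered_zero_zero, bordered_zero_succ, bordered_succ_zero, hα 0 (by omega),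
              hε 0 (by omega), Finset.prod_range_succ', Fin.castSucc_zero,
                if_neg (Fin.succ_ne_zero i)]
            ring
          | succ j =>
            simp only [H, stairs_succ, Fin.cons_succ]
            simp [Fin.ext_iff]
    rw [key]
    refine (UEquiv.of_left_mul (by rw [det_lowerBorder]; exact isUnit_one) _).trans ?_
    refine (UEquiv.of_right_mul (by rw [Matrix.det_transpose, det_lowerBorder]; exact isUnit_one)
      _).trans ?_
    rw [← bordered_diagonal]
    exact UEquiv.bordered _ ((UEquiv.of_right_mul hdetN _).trans ih')

end Stairs

section OneStep
variable {F : Type*} [Field F]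

theorem exists_monic_lcm {p q : F[X]} (hp : p ≠ 0) (hq : q ≠ 0) :
    ∃ L : F[X], L.Monic ∧ p ∣ L ∧ q ∣ L ∧ ∀ z, p ∣ z → q ∣ z → L ∣ z := by
  classical
  have h0 : EuclideanDomain.lcm p q ≠ 0 := by
    rw [Ne, EuclideanDomain.lcm_eq_zero_iff]; tauto
  refine ⟨normalize (EuclideanDomain.lcm p q), monic_normalize h0, ?_, ?_, fun z h1 h2 => ?_⟩
  · rw [dvd_normalize_iff]; exact EuclideanDomain.dvd_lcm_left _ _
  · rw [dvd_normalize_iff]; exact EuclideanDomain.dvd_lcm_right _ _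
  · rw [normalize_dvd_iff]; exact EuclideanDomain.lcm_dvd h1 h2

theorem exists_rowReduced_uEquiv_diagonal {m : ℕ} {α ε : ℕ → F[X]}
    (hαm : ∀ i < m + 1, (α i).Monic) (hdeg : ∑ i ∈ Finset.range (m + 1), (α i).natDegree = m + 1)
    (hεm : ∀ i < m, (ε i).Monic) (h1 : ∀ i < m, α i ∣ ε i) (h2 : ∀ i < m, ε i ∣ α (i + 1)) :
    ∃ D, UEquiv D (Matrix.diagonal fun i : Fin (m + 1) => α i) ∧
      RowReduced (Fin.lastCases (m + 1 - ∑ i ∈ Finset.range m, (ε i).natDegree)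
        fun j : Fin m => (ε j).natDegree) D ∧
      ∀ (i) (j : Fin m), D i j.castSucc = if i = j.castSucc then ε j else 0 := by
  have hq : ∀ i, ∃ q, i < m → α (i + 1) = ε i * q := fun i => by
    by_cases hi : i < m
    · obtain ⟨q, hq⟩ := h2 i hi; exact ⟨q, fun _ => hq⟩
    · exact ⟨0, fun h => absurd h hi⟩
  have hs : ∀ i, ∃ s, i < m → ε i = α i * s := fun i => by
    by_cases hi : i < m
    · obtain ⟨q, hq⟩ := h1 i hi; exact ⟨q, fun _ => hq⟩
    · exact ⟨0, fun h => absurd h hi⟩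
  choose q hq using hq
  choose s hs using hs
  have hH := uEquiv_stairs m α ε q s hq hs
  set f : ℕ → F[X] := fun i => α 0 * ∏ l ∈ Finset.range i, q l with hf
  have hprod : f m * ∏ i ∈ Finset.range m, ε i = ∏ i ∈ Finset.range (m + 1), α i := by
    rw [hf, Finset.prod_range_succ', mul_comm _ (α 0), mul_assoc, ← Finset.prod_mul_distrib]
    congr 1
    exact Finset.prod_congr rfl fun i hi => by rw [hq i (Finset.mem_range.1 hi), mul_comm]
  have hεp : (∏ i ∈ Finset.range m, ε i).Monic :=
    monic_prod_of_monic _ _ fun i hi => hεm i (Finset.mem_range.1 hi)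
  have hfm : (f m).Monic := by
    refine Monic.of_mul_monic_right hεp ?_
    rw [hprod]
    exact monic_prod_of_monic _ _ fun i hi => hαm i (Finset.mem_range.1 hi)
  have hfd : (f m).natDegree + ∑ i ∈ Finset.range m, (ε i).natDegree = m + 1 := by
    rw [← natDegree_prod_of_monic _ _ fun i hi => hεm i (Finset.mem_range.1 hi),
      ← hfm.natDegree_mul hεp, hprod,
      natDegree_prod_of_monic _ _ fun i hi => hαm i (Finset.mem_range.1 hi), hdeg]
  set c : Fin m → F[X] := fun j => -(f j /ₘ ε j)
  set D := (stairs m f ε * lowerBorder c).submatrix id (finRotate (m + 1)) with hD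
  have hDc : ∀ (i) (j : Fin m), D i j.castSucc = if i = j.castSucc then ε j else 0 := by
    intro i j
    rw [hD, Matrix.submatrix_apply, finRotate_apply, Fin.coeSucc_eq_succ,
      mul_lowerBorder_succ, stairs_succ, id]
  have hDl : ∀ i, D i (Fin.last m) =
      f i + ∑ j : Fin m, (if i = j.castSucc then ε j else 0) * c j := by
    intro i
    rw [hD, Matrix.submatrix_apply, finRotate_last, mul_lowerBorder_zero, stairs_zero, id]
    simp only [stairs_succ]
  have hDll : D (Fin.last m) (Fin.last m) = f m := by
    rw [hDl]
    simp [fun x : Fin m => (Fin.castSucc_ne_last x).symm]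
  have hDcl : ∀ j : Fin m, D j.castSucc (Fin.last m) = f j %ₘ ε j := by
    intro j
    rw [hDl]
    have : ∀ k : Fin m, (j.castSucc = k.castSucc ↔ j = k) := fun k => by simp
    simp only [this, ite_mul, zero_mul, Finset.sum_ite_eq, Finset.mem_univ, if_true]
    rw [modByMonic_eq_sub_mul_div]
    simp [c, sub_eq_add_neg]
  refine ⟨D, ?_, ⟨?_, ?_⟩, hDc⟩
  · exact (UEquiv.submatrix_right _ _).trans ((UEquiv.of_right_mul
      (by rw [det_lowerBorder]; exact isUnit_one) _).trans hH)
  · intro i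
    induction i using Fin.lastCases with
    | last => simp only [hDll, Fin.lastCases_last]; exact ⟨hfm, by omega⟩
    | cast j => simp only [hDc, if_pos, Fin.lastCases_castSucc]; exact ⟨hεm j j.2, trivial⟩
  · intro i j hij k hk
    induction j using Fin.lastCases with
    | last =>
      induction i using Fin.lastCases with
      | last => exact absurd rfl hij
      | cast i =>
        simp only [Fin.lastCases_castSucc] at hk
        rw [hDcl]
        refine coeff_eq_zero_of_degree_lt ((degree_modByMonic_lt _ (hεm i i.2)).trans_le ?_)
        exact degree_le_natDegree.trans (by exact_mod_cast hk)
    | cast j => rw [hDc, if_neg hij, coeff_zero]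

theorem exists_realizes_rank_sub_le_one {n : ℕ} {α γ : ℕ → F[X]}
    (hα : ∀ i, α i ∣ α (i + 1)) (hγ : ∀ i, γ i ∣ γ (i + 1))
    (hαm : ∀ i < n, (α i).Monic) (hγm : ∀ i < n, (γ i).Monic)
    (hαd : ∑ i ∈ Finset.range n, (α i).natDegree = n)
    (hγd : ∑ i ∈ Finset.range n, (γ i).natDegree = n)
    (h1 : ∀ i, i + 1 < n → α i ∣ γ (i + 1)) (h2 : ∀ i, i + 1 < n → γ i ∣ α (i + 1)) :
    ∃ a b, Realizes (Matrix.diagonal fun i : Fin n => α i) a ∧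
      Realizes (Matrix.diagonal fun i : Fin n => γ i) b ∧ (a - b).rank ≤ 1 := by
  rcases n with _ | m
  · obtain ⟨a, ha⟩ := (rowReduced_diagonal (α := fun i : Fin 0 => α i) (by simp)).exists_realizes
      (by simp)
    obtain ⟨b, hb⟩ := (rowReduced_diagonal (α := fun i : Fin 0 => γ i) (by simp)).exists_realizes
      (by simp)
    exact ⟨a, b, ha, hb, (Matrix.rank_le_width _).trans (by simp)⟩
  have hL : ∀ i, ∃ L : F[X], i < m → L.Monic ∧ α i ∣ L ∧ γ i ∣ L ∧
      ∀ z, α i ∣ z → γ i ∣ z → L ∣ z := fun i => by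
    by_cases hi : i < m
    · obtain ⟨L, hL⟩ := exists_monic_lcm (hαm i (by omega)).ne_zero (hγm i (by omega)).ne_zero
      exact ⟨L, fun _ => hL⟩
    · exact ⟨0, fun h => absurd h hi⟩
  choose ε hε using hL
  have hεα : ∀ i < m, ε i ∣ α (i + 1) := fun i hi =>
    (hε i hi).2.2.2 _ (hα i) (h2 i (by omega))
  have hεγ : ∀ i < m, ε i ∣ γ (i + 1) := fun i hi =>
    (hε i hi).2.2.2 _ (h1 i (by omega)) (hγ i)
  obtain ⟨D, hDα, hD, hDc⟩ := exists_rowReduced_uEquiv_diagonal hαm hαd (fun i hi => (hε i hi).1)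
    (fun i hi => (hε i hi).2.1) hεα
  obtain ⟨D', hDγ, hD', hDc'⟩ := exists_rowReduced_uEquiv_diagonal hγm hγd (fun i hi => (hε i hi).1)
    (fun i hi => (hε i hi).2.2.1) hεγ
  have hle : ∑ i ∈ Finset.range m, (ε i).natDegree ≤ m + 1 := by
    rw [← hαd, Finset.sum_range_succ']
    refine le_add_right (Finset.sum_le_sum fun i hi => ?_)
    have hi := Finset.mem_range.1 hi
    exact natDegree_le_of_dvd (hεα i hi) (hαm (i + 1) (by omega)).ne_zero
  obtain ⟨a, b, ha, hb, hab⟩ := hD.exists_realizes_rank_sub_le_one (by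
    rw [Fin.sum_univ_castSucc]
    simp only [Fin.lastCases_castSucc, Fin.lastCases_last]
    rw [Fin.sum_univ_eq_sum_range fun i => (ε i).natDegree]
    omega) hD' (Fin.last m) (fun i j hj => by
      induction j using Fin.lastCases with
      | last => exact absurd rfl hj
      | cast j => rw [hDc, hDc'])
  exact ⟨a, b, ha.of_uEquiv hDα.symm, hb.of_uEquiv hDγ.symm, hab⟩

end OneStep

section DegreeBound

theorem exists_threshold {n : ℕ} {a : ℕ → ℕ} (ha : ∀ i j, i ≤ j → j < n → a i ≤ a j) (t : ℕ) :
    ∃ x ≤ n, ∀ i < n, t ≤ a i ↔ x ≤ i := by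
  classical
  have h : ∃ x, ∀ i, x ≤ i → i < n → t ≤ a i := ⟨n, fun i h1 h2 => by omega⟩
  refine ⟨Nat.find h, Nat.find_min' h fun i h1 h2 => by omega, fun i hi =>
    ⟨fun hti => ?_, fun hxi => Nat.find_spec h i hxi hi⟩⟩
  exact Nat.find_min' h fun j hij hj => hti.trans (ha i j hij hj)

theorem sum_ite_le_eq_sub (n x : ℕ) : (∑ i ∈ Finset.range n, if x ≤ i then 1 else 0) = n - x := by
  induction n with
  | zero => simp
  | succ n ih => rw [Finset.sum_range_succ, ih]; split_ifs <;> omega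

theorem sum_range_eq_sum_levels {n T : ℕ} {l : ℕ → ℕ} (h : ∀ i < n, l i ≤ T) :
    ∑ i ∈ Finset.range n, l i =
      ∑ t ∈ Finset.range T, ∑ i ∈ Finset.range n, if t + 1 ≤ l i then 1 else 0 := by
  rw [Finset.sum_comm]
  refine Finset.sum_congr rfl fun i hi => ?_
  have h1 := h i (Finset.mem_range.1 hi)
  have : ∀ T, (∑ t ∈ Finset.range T, if t + 1 ≤ l i then 1 else 0) = min (l i) T := by
    intro T
    induction T with
    | zero => simp
    | succ n ih => rw [Finset.sum_range_succ, ih]; split_ifs <;> omega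
  rw [this]; omega

theorem interlaced_sum_le {n ρ : ℕ} {a b l : ℕ → ℕ} (ha : ∀ i j, i ≤ j → j < n → a i ≤ a j)
    (hb : ∀ i j, i ≤ j → j < n → b i ≤ b j)
    (hab : ∀ i, i + (ρ + 1) < n → a i ≤ b (i + (ρ + 1)) ∧ b i ≤ a (i + (ρ + 1)))
    (hl : ∀ i < n, l i ≤ max (if 1 ≤ i then a (i - 1) else 0) (if ρ ≤ i then b (i - ρ) else 0)) :
    (ρ + 1) * ∑ i ∈ Finset.range n, l i ≤
      ρ * ∑ i ∈ Finset.range n, a i + ∑ i ∈ Finset.range n, b i := by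
  set T := ∑ i ∈ Finset.range n, a i + ∑ i ∈ Finset.range n, b i + ∑ i ∈ Finset.range n, l i
  have hT : ∀ f : ℕ → ℕ, ∀ i < n, f i ≤ ∑ i ∈ Finset.range n, f i := fun f i hi =>
    Finset.single_le_sum (f := f) (fun _ _ => Nat.zero_le _) (Finset.mem_range.2 hi)
  rw [sum_range_eq_sum_levels (l := l) (T := T) fun i hi => by have := hT l i hi; omega,
    sum_range_eq_sum_levels (l := a) (T := T) fun i hi => by have := hT a i hi; omega,
    sum_range_eq_sum_levels (l := b) (T := T) fun i hi => by have := hT b i hi; omega,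
    Finset.mul_sum, Finset.mul_sum, ← Finset.sum_add_distrib]
  refine Finset.sum_le_sum fun t _ => ?_
  obtain ⟨x, hx, hxa⟩ := exists_threshold ha (t + 1)
  obtain ⟨y, hy, hyb⟩ := exists_threshold hb (t + 1)
  have hA : (∑ i ∈ Finset.range n, if t + 1 ≤ a i then 1 else 0) = n - x := by
    rw [← sum_ite_le_eq_sub]
    exact Finset.sum_congr rfl fun i hi => by simp only [hxa i (Finset.mem_range.1 hi)]
  have hB : (∑ i ∈ Finset.range n, if t + 1 ≤ b i then 1 else 0) = n - y := by
    rw [← sum_ite_le_eq_sub]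
    exact Finset.sum_congr rfl fun i hi => by simp only [hyb i (Finset.mem_range.1 hi)]
  have hL : (∑ i ∈ Finset.range n, if t + 1 ≤ l i then 1 else 0) ≤ n - min (x + 1) (y + ρ) := by
    rw [← sum_ite_le_eq_sub]
    refine Finset.sum_le_sum fun i hi => ?_
    have hi := Finset.mem_range.1 hi
    by_cases h : t + 1 ≤ l i
    · have h1 := h.trans (hl i hi)
      have : min (x + 1) (y + ρ) ≤ i := by
        rcases le_max_iff.1 h1 with h2 | h2
        · by_cases h3 : 1 ≤ i
          · rw [if_pos h3, hxa (i - 1) (by omega)] at h2; omega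
          · rw [if_neg h3] at h2; omega
        · by_cases h3 : ρ ≤ i
          · rw [if_pos h3, hyb (i - ρ) (by omega)] at h2; omega
          · rw [if_neg h3] at h2; omega
      rw [if_pos this, if_pos h]
    · rw [if_neg h]; exact Nat.zero_le _
  have hyx : y ≤ x + (ρ + 1) := by
    by_cases h : x + (ρ + 1) < n
    · exact (hyb _ h).1 (((hxa x (by omega)).2 le_rfl).trans (hab x h).1)
    · omega
  have hxy : x ≤ y + (ρ + 1) := by
    by_cases h : y + (ρ + 1) < n
    · exact (hxa _ h).1 (((hyb y (by omega)).2 le_rfl).trans (hab y h).2)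
    · omega
  rw [hA, hB]
  refine (Nat.mul_le_mul_left _ hL).trans ?_
  obtain ⟨u, rfl⟩ := Nat.exists_eq_add_of_le hx
  obtain ⟨v, hv⟩ := Nat.exists_eq_add_of_le hy
  rw [hv, Nat.add_sub_cancel_left, ← hv, Nat.add_sub_cancel_left]
  rcases le_total (x + 1) (y + ρ) with h | h
  · rw [min_eq_left h]
    rcases u with _ | u
    · simp
    · rw [show x + (u + 1) - (x + 1) = u by omega]
      nlinarith
  · rw [min_eq_right h, hv]
    rcases le_total v ρ with h' | h'
    · rw [show y + v - (y + ρ) = 0 by omega]; simp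
    · obtain ⟨w, rfl⟩ := Nat.exists_eq_add_of_le h'
      rw [show y + (ρ + w) - (y + ρ) = w by omega]
      have : w ≤ u + 1 := by omega
      nlinarith

end DegreeBound

section Interpolation
variable {F : Type*} [Field F]

theorem multiplicity_le_max_of_lcm {p a b L : F[X]} (hp : Prime p) (ha : a ≠ 0) (hb : b ≠ 0)
    (hL : ∀ z, a ∣ z → b ∣ z → L ∣ z) :
    multiplicity p L ≤ max (multiplicity p a) (multiplicity p b) := by
  obtain ⟨a', ha', hpa⟩ :=
    (FiniteMultiplicity.of_prime_left hp ha).exists_eq_pow_mul_and_not_dvd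
  obtain ⟨b', hb', hpb⟩ :=
    (FiniteMultiplicity.of_prime_left hp hb).exists_eq_pow_mul_and_not_dvd
  set u := multiplicity p a
  set w := multiplicity p b
  have h1 : L ∣ p ^ max u w * (a' * b') := by
    refine hL _ ?_ ?_
    · rw [ha']; exact mul_dvd_mul (pow_dvd_pow p (le_max_left u w)) (dvd_mul_right _ _)
    · rw [hb']; exact mul_dvd_mul (pow_dvd_pow p (le_max_right u w)) (dvd_mul_left _ _)
  have h2 := emultiplicity_le_emultiplicity_of_dvd_right (a := p) h1
  rw [emultiplicity_mul hp, emultiplicity_mul hp, emultiplicity_pow_self_of_prime hp,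
    emultiplicity_eq_zero.2 hpa, emultiplicity_eq_zero.2 hpb, add_zero, add_zero] at h2
  have hL0 : L ≠ 0 := by
    rintro rfl
    have h := zero_dvd_iff.1 (hL (a * b) (dvd_mul_right _ _) (dvd_mul_left _ _))
    exact mul_ne_zero ha hb h
  rw [(FiniteMultiplicity.of_prime_left hp hL0).emultiplicity_eq_multiplicity] at h2
  exact_mod_cast h2

theorem sum_natDegree_lcm_le {n ρ : ℕ} {α β L : ℕ → F[X]} (hα : ∀ i, α i ∣ α (i + 1))
    (hβ : ∀ i, β i ∣ β (i + 1)) (hα0 : ∀ i < n, α i ≠ 0) (hβ0 : ∀ i < n, β i ≠ 0)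
    (hab : ∀ i, i + (ρ + 1) < n → α i ∣ β (i + (ρ + 1)) ∧ β i ∣ α (i + (ρ + 1)))
    (hL0 : ∀ i < n, L i ≠ 0)
    (hL : ∀ i < n, ∀ z, (if 1 ≤ i then α (i - 1) else 1) ∣ z →
      (if ρ ≤ i then β (i - ρ) else 1) ∣ z → L i ∣ z) :
    (ρ + 1) * ∑ i ∈ Finset.range n, (L i).natDegree ≤
      ρ * ∑ i ∈ Finset.range n, (α i).natDegree + ∑ i ∈ Finset.range n, (β i).natDegree := by
  have h0 : ∀ f : ℕ → F[X], (∀ i < n, f i ≠ 0) → ∏ i ∈ Finset.range n, f i ≠ 0 := fun f hf =>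
    Finset.prod_ne_zero_iff.2 fun i hi => hf i (Finset.mem_range.1 hi)
  have key : (∏ i ∈ Finset.range n, L i) ^ (ρ + 1) ∣
      (∏ i ∈ Finset.range n, α i) ^ ρ * ∏ i ∈ Finset.range n, β i := by
    rw [UniqueFactorizationMonoid.dvd_iff_emultiplicity_le (pow_ne_zero _ (h0 L hL0))]
    intro p hp
    have hm : ∀ f : ℕ → F[X], (∀ i < n, f i ≠ 0) →
        emultiplicity p (∏ i ∈ Finset.range n, f i) =
          ((∑ i ∈ Finset.range n, multiplicity p (f i) : ℕ) : ℕ∞) := by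
      intro f hf
      rw [Finset.emultiplicity_prod hp, Nat.cast_sum]
      exact Finset.sum_congr rfl fun i hi => (FiniteMultiplicity.of_prime_left hp
        (hf i (Finset.mem_range.1 hi))).emultiplicity_eq_multiplicity
    have hle : ∀ {x y : F[X]}, y ≠ 0 → x ∣ y → multiplicity p x ≤ multiplicity p y := by
      intro x y hy hxy
      have := emultiplicity_le_emultiplicity_of_dvd_right (a := p) hxy
      rw [(FiniteMultiplicity.of_prime_left hp hy).emultiplicity_eq_multiplicity,
        (FiniteMultiplicity.of_prime_left hp (ne_zero_of_dvd_ne_zero hy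
          hxy)).emultiplicity_eq_multiplicity] at this
      exact_mod_cast this
    have h1 : multiplicity p (1 : F[X]) = 0 := multiplicity_of_one_right hp.not_isUnit
    rw [emultiplicity_mul hp, emultiplicity_pow hp, emultiplicity_pow hp, hm L hL0,
      hm α hα0, hm β hβ0]
    have := interlaced_sum_le (n := n) (ρ := ρ) (a := fun i => multiplicity p (α i))
      (b := fun i => multiplicity p (β i)) (l := fun i => multiplicity p (L i))
      (fun i j hij hj => hle (hα0 j hj) (dvd_of_le_of_chain hα hij))
      (fun i j hij hj => hle (hβ0 j hj) (dvd_of_le_of_chain hβ hij))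
      (fun i hi => ⟨hle (hβ0 _ hi) (hab i hi).1, hle (hα0 _ hi) (hab i hi).2⟩)
      (fun i hi => by
        refine (multiplicity_le_max_of_lcm hp ?_ ?_ (hL i hi)).trans (le_of_eq ?_)
        · split_ifs
          exacts [hα0 _ (by omega), one_ne_zero]
        · split_ifs
          exacts [hβ0 _ (by omega), one_ne_zero]
        · congr 1
          · split_ifs <;> simp [h1]
          · split_ifs <;> simp [h1])
    exact_mod_cast this
  have hd : ∀ f : ℕ → F[X], (∀ i < n, f i ≠ 0) → (∏ i ∈ Finset.range n, f i).natDegree =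
      ∑ i ∈ Finset.range n, (f i).natDegree := fun f hf =>
    natDegree_prod _ _ fun i hi => hf i (Finset.mem_range.1 hi)
  have h2 := natDegree_le_of_dvd key (mul_ne_zero (pow_ne_zero _ (h0 α hα0)) (h0 β hβ0))
  rwa [natDegree_pow, natDegree_mul (pow_ne_zero _ (h0 α hα0)) (h0 β hβ0), natDegree_pow,
    hd L hL0, hd α hα0, hd β hβ0] at h2

/-- Interlacing at distance `ρ + 1` factors through interlacings at distances `1` and `ρ`. -/
theorem exists_interpolating_chain {n ρ : ℕ} (hρ : 1 ≤ ρ) {α β : ℕ → F[X]}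
    (hα : ∀ i, α i ∣ α (i + 1)) (hβ : ∀ i, β i ∣ β (i + 1))
    (hαm : ∀ i < n, (α i).Monic) (hβm : ∀ i < n, (β i).Monic)
    (hαd : ∑ i ∈ Finset.range n, (α i).natDegree = n)
    (hβd : ∑ i ∈ Finset.range n, (β i).natDegree = n)
    (hab : ∀ i, i + (ρ + 1) < n → α i ∣ β (i + (ρ + 1)) ∧ β i ∣ α (i + (ρ + 1))) :
    ∃ γ : ℕ → F[X], (∀ i, γ i ∣ γ (i + 1)) ∧ (∀ i < n, (γ i).Monic) ∧
      ∑ i ∈ Finset.range n, (γ i).natDegree = n ∧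
      (∀ i, i + 1 < n → α i ∣ γ (i + 1) ∧ γ i ∣ α (i + 1)) ∧
      ∀ i, i + ρ < n → γ i ∣ β (i + ρ) ∧ β i ∣ γ (i + ρ) := by
  have hL : ∀ i, ∃ L : F[X], i < n → L.Monic ∧ (if 1 ≤ i then α (i - 1) else 1) ∣ L ∧
      (if ρ ≤ i then β (i - ρ) else 1) ∣ L ∧ ∀ z, (if 1 ≤ i then α (i - 1) else 1) ∣ z →
      (if ρ ≤ i then β (i - ρ) else 1) ∣ z → L ∣ z := fun i => by
    by_cases hi : i < n
    · obtain ⟨L, hL⟩ := exists_monic_lcm (p := if 1 ≤ i then α (i - 1) else 1)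
        (q := if ρ ≤ i then β (i - ρ) else 1)
        (by split_ifs; exacts [(hαm _ (by omega)).ne_zero, one_ne_zero])
        (by split_ifs; exacts [(hβm _ (by omega)).ne_zero, one_ne_zero])
      exact ⟨L, fun _ => hL⟩
    · exact ⟨0, fun h => absurd h hi⟩
  choose L hL using hL
  have hαL : ∀ i, i + 1 < n → α i ∣ L (i + 1) := fun i hi => by
    simpa using (hL (i + 1) hi).2.1
  have hβL : ∀ i, i + ρ < n → β i ∣ L (i + ρ) := fun i hi => by
    simpa using (hL (i + ρ) hi).2.2.1
  have hLdvd : ∀ i < n, ∀ z, (1 ≤ i → α (i - 1) ∣ z) → (ρ ≤ i → β (i - ρ) ∣ z) → L i ∣ z := by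
    intro i hi z h1 h2
    refine (hL i hi).2.2.2 z ?_ ?_
    · split_ifs with h; exacts [h1 h, one_dvd _]
    · split_ifs with h; exacts [h2 h, one_dvd _]
  have hLα : ∀ i, i + 1 < n → L i ∣ α (i + 1) := fun i hi =>
    hLdvd i (by omega) _ (fun _ => dvd_of_le_of_chain hα (by omega)) fun h => by
      have := (hab (i - ρ) (by omega)).2
      rwa [show i - ρ + (ρ + 1) = i + 1 by omega] at this
  have hLβ : ∀ i, i + ρ < n → L i ∣ β (i + ρ) := fun i hi =>
    hLdvd i (by omega) _ (fun h => by
      have := (hab (i - 1) (by omega)).1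
      rwa [show i - 1 + (ρ + 1) = i + ρ by omega] at this)
      fun _ => dvd_of_le_of_chain hβ (by omega)
  have hLL : ∀ i, i + 1 < n → L i ∣ L (i + 1) := fun i hi =>
    hLdvd i (by omega) _ (fun _ => (dvd_of_le_of_chain hα (by omega)).trans (hαL i hi)) fun h => by
      have := hβL (i + 1 - ρ) (by omega)
      rw [show i + 1 - ρ + ρ = i + 1 by omega] at this
      exact (dvd_of_le_of_chain hβ (by omega)).trans this
  have hLd : ∑ i ∈ Finset.range n, (L i).natDegree ≤ n := by
    have := sum_natDegree_lcm_le hα hβ (fun i hi => (hαm i hi).ne_zero)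
      (fun i hi => (hβm i hi).ne_zero) hab (fun i hi => (hL i hi).1.ne_zero)
      fun i hi => (hL i hi).2.2.2
    rw [hαd, hβd] at this
    have h2 : ρ * n + n = (ρ + 1) * n := by ring
    exact Nat.le_of_mul_le_mul_left (h2 ▸ this) (Nat.succ_pos ρ)
  set k := n - ∑ i ∈ Finset.range n, (L i).natDegree with hk
  refine ⟨fun i => if i < n then L i * (if i + 1 = n then X ^ k else 1) else 0, ?_, ?_, ?_, ?_, ?_⟩
  · intro i
    by_cases h : i + 1 < n
    · simp only [if_pos h, if_pos (show i < n by omega), if_neg (show ¬ i + 1 = n by omega),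
        mul_one]
      exact (hLL i h).trans (dvd_mul_right _ _)
    · simp only [if_neg h]; exact dvd_zero _
  · intro i hi
    simp only [if_pos hi]
    refine (hL i hi).1.mul ?_
    split_ifs
    exacts [monic_X_pow _, monic_one]
  · rcases n with _ | m
    · simp
    · have : ∀ i ∈ Finset.range m, (if i < m + 1 then L i * (if i + 1 = m + 1 then X ^ k else 1)
          else 0).natDegree = (L i).natDegree := fun i hi => by
        have := Finset.mem_range.1 hi
        rw [if_pos (by omega), if_neg (by omega), mul_one]
      rw [Finset.sum_range_succ, Finset.sum_congr rfl this]
      beta_reduce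
      rw [if_pos (by omega), if_pos rfl, (hL m (by omega)).1.natDegree_mul (monic_X_pow _),
        natDegree_X_pow, ← add_assoc,
        ← Finset.sum_range_succ fun i => (L i).natDegree]
      omega
  · intro i hi
    simp only [if_pos hi, if_pos (show i < n by omega), if_neg (show ¬ i + 1 = n by omega), mul_one]
    exact ⟨(hαL i hi).trans (dvd_mul_right _ _), hLα i hi⟩
  · intro i hi
    simp only [if_pos hi, if_pos (show i < n by omega), if_neg (show ¬ i + 1 = n by omega), mul_one]
    exact ⟨hLβ i hi, (hβL i hi).trans (dvd_mul_right _ _)⟩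

theorem exists_realizes_rank_sub_le {n : ℕ} (r : ℕ) : ∀ {α β : ℕ → F[X]},
    (∀ i, α i ∣ α (i + 1)) → (∀ i, β i ∣ β (i + 1)) →
    (∀ i < n, (α i).Monic) → (∀ i < n, (β i).Monic) →
    ∑ i ∈ Finset.range n, (α i).natDegree = n → ∑ i ∈ Finset.range n, (β i).natDegree = n →
    (∀ i, i + r < n → α i ∣ β (i + r) ∧ β i ∣ α (i + r)) →
    ∃ a b, Realizes (Matrix.diagonal fun i : Fin n => α i) a ∧
      Realizes (Matrix.diagonal fun i : Fin n => β i) b ∧ (a - b).rank ≤ r := by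
  induction r with
  | zero =>
    intro α β hα hβ hαm hβm hαd hβd hab
    have h : (fun i : Fin n => β i) = fun i : Fin n => α i := by
      ext1 i
      exact eq_of_monic_of_associated (hβm i i.2) (hαm i i.2)
        (associated_of_dvd_dvd (hab i i.2).2 (hab i i.2).1)
    obtain ⟨a, ha⟩ := (rowReduced_diagonal fun i : Fin n => hαm i i.2).exists_realizes
      (by rw [Fin.sum_univ_eq_sum_range fun i => (α i).natDegree, hαd])
    exact ⟨a, a, ha, h ▸ ha, by simp⟩
  | succ ρ ih =>
    intro α β hα hβ hαm hβm hαd hβd hab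
    rcases Nat.eq_zero_or_pos ρ with rfl | hρ
    · exact exists_realizes_rank_sub_le_one hα hβ hαm hβm hαd hβd (fun i hi => (hab i hi).1)
        fun i hi => (hab i hi).2
    obtain ⟨γ, hγ, hγm, hγd, hαγ, hγβ⟩ :=
      exists_interpolating_chain hρ hα hβ hαm hβm hαd hβd hab
    obtain ⟨a, c, ha, hc, hac⟩ := exists_realizes_rank_sub_le_one hα hγ hαm hγm hαd hγd
      (fun i hi => (hαγ i hi).1) fun i hi => (hαγ i hi).2
    obtain ⟨c', b, hc', hb, hcb⟩ := ih hγ hβ hγm hβm hγd hβd hγβ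
    obtain ⟨g, hg, hcg⟩ := hc'.exists_conj hc
    refine ⟨a, g * b * g⁻¹, ha, hb.conj hg, ?_⟩
    have : a - g * b * g⁻¹ = (a - c) + g * (c' - b) * g⁻¹ := by
      rw [Matrix.mul_sub, Matrix.sub_mul, ← hcg, Matrix.mul_assoc c, Matrix.mul_nonsing_inv g hg,
        Matrix.mul_one]
      abel
    rw [this]
    have h1 : (g * (c' - b) * g⁻¹).rank ≤ ρ :=
      (Matrix.rank_mul_le_left _ _).trans ((Matrix.rank_mul_le_right _ _).trans hcb)
    have h2 := matrix_rank_add_le (a - c) (g * (c' - b) * g⁻¹)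
    omega

end Interpolation

section Reachable
variable {F : Type*} [Field F] {n : ℕ}

/-- Some strict equivalent of `B₀ + s B₁` differs from `A₀ + s A₁` by a pencil of normal
rank `r`. -/
def RankReachable (A₀ A₁ B₀ B₁ : Matrix (Fin n) (Fin n) F) (r : ℕ) : Prop :=
  ∃ Q R : Matrix (Fin n) (Fin n) F, IsUnit Q.det ∧ IsUnit R.det ∧
    normalRank (pencilOf (Q * B₀ * R - A₀) (Q * B₁ * R - A₁)) = r

theorem map_mul_pencilOf_mul (Q R G₀ G₁ : Matrix (Fin n) (Fin n) F) :
    Q.map C * pencilOf G₀ G₁ * R.map C = pencilOf (Q * G₀ * R) (Q * G₁ * R) := by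
  simp only [pencilOf, Matrix.map_mul, Matrix.mul_add, Matrix.add_mul, Matrix.mul_smul,
    Matrix.smul_mul]

theorem pencilOf_sub (G₀ G₁ H₀ H₁ : Matrix (Fin n) (Fin n) F) :
    pencilOf (G₀ - H₀) (G₁ - H₁) = pencilOf G₀ G₁ - pencilOf H₀ H₁ := by
  ext1 i j
  simp [pencilOf]
  ring

theorem isUnit_det_map_C {Q : Matrix (Fin n) (Fin n) F} (hQ : IsUnit Q.det) :
    IsUnit (Q.map (C : F →+* F[X])).det := by
  have := hQ.map (C : F →+* F[X])
  rwa [RingHom.map_det] at this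

theorem isPencil_pencilOf (G₀ G₁ : Matrix (Fin n) (Fin n) F) : IsPencil (pencilOf G₀ G₁) := by
  intro i j
  simp only [pencilOf, Matrix.add_apply, Matrix.smul_apply, Matrix.map_apply, smul_eq_mul]
  rw [add_comm, mul_comm]
  exact degree_linear_le

theorem exists_pencil_iff_rankReachable {A₀ A₁ B₀ B₁ : Matrix (Fin n) (Fin n) F} {r : ℕ} :
    (∃ P : Matrix (Fin n) (Fin n) F[X], IsPencil P ∧ normalRank P = r ∧
      StrictEquiv (pencilOf A₀ A₁ + P) (pencilOf B₀ B₁)) ↔ RankReachable A₀ A₁ B₀ B₁ r := by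
  constructor
  · rintro ⟨P, -, hP, Q, R, hQ, hR, h⟩
    refine ⟨Q, R, hQ, hR, ?_⟩
    rw [pencilOf_sub, ← map_mul_pencilOf_mul]
    rw [← h, add_sub_cancel_left, hP]
  · rintro ⟨Q, R, hQ, hR, h⟩
    refine ⟨_, isPencil_pencilOf _ _, h, Q, R, hQ, hR, ?_⟩
    rw [pencilOf_sub, ← map_mul_pencilOf_mul, add_sub_cancel]

theorem RankReachable.invert_iff {A₀ A₁ B₀ B₁ : Matrix (Fin n) (Fin n) F} {r : ℕ} (c : F) :
    RankReachable A₁ (A₀ + c • A₁) B₁ (B₀ + c • B₁) r ↔ RankReachable A₀ A₁ B₀ B₁ r := by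
  refine exists_congr fun Q => exists_congr fun R => and_congr_right fun _ =>
    and_congr_right fun _ => ?_
  have : Q * (B₀ + c • B₁) * R - (A₀ + c • A₁) = Q * B₀ * R - A₀ + c • (Q * B₁ * R - A₁) := by
    simp only [Matrix.mul_add, Matrix.add_mul, Matrix.mul_smul, Matrix.smul_mul, smul_sub]
    abel
  rw [this, normalRank_pencilOf_invert]

theorem normalRank_map_C (P : Matrix (Fin n) (Fin n) F) :
    normalRank (P.map (C : F →+* F[X])) = P.rank := by
  rw [normalRank, Matrix.map_map]
  exact rank_map_ringHom ((algebraMap F[X] (RatFunc F)).comp C) P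

theorem normalRank_eq_of_det_ne_zero {M : Matrix (Fin n) (Fin n) F[X]} (h : M.det ≠ 0) :
    normalRank M = n := by
  have : (M.map (algebraMap F[X] (RatFunc F))).det ≠ 0 := by
    have h2 := (map_ne_zero_iff _ (IsFractionRing.injective F[X] (RatFunc F))).2 h
    rwa [RingHom.map_det] at h2
  rw [normalRank]
  simpa using Matrix.rank_of_isUnit _ ((Matrix.isUnit_iff_isUnit_det _).2 this.isUnit)

theorem exists_similar_of_realizes {A₀ A₁ a : Matrix (Fin n) (Fin n) F}
    {D : Matrix (Fin n) (Fin n) F[X]}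
    (hA : IsUnit A₁.det) (hD : UEquiv (pencilOf A₀ A₁) D) (ha : Realizes D a) :
    ∃ g : Matrix (Fin n) (Fin n) F, IsUnit g.det ∧ A₀ = -(A₁ * (g⁻¹ * a * g)) := by
  have h : A₁.map (C : F →+* F[X]) * ((X : F[X]) • (1 : Matrix (Fin n) (Fin n) F[X]) -
      (-(A₁⁻¹ * A₀)).map C) = pencilOf A₀ A₁ := by
    have : (-(A₁⁻¹ * A₀)).map (C : F →+* F[X]) = -((A₁⁻¹ * A₀).map C) := by
      ext1 i j
      simp only [Matrix.map_apply, Matrix.neg_apply, map_neg]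
    rw [this, sub_neg_eq_add, Matrix.mul_add, ← Matrix.map_mul,
      Matrix.mul_nonsing_inv_cancel_left _ _ hA,
      Matrix.mul_smul, Matrix.mul_one, pencilOf, add_comm]
  have h2 := ((UEquiv.of_left_mul (isUnit_det_map_C hA) _).symm.trans (h ▸ hD))
  obtain ⟨g, hg, hga⟩ := (ha.of_uEquiv h2).similar_of_linear
  refine ⟨g, hg, ?_⟩
  rw [Matrix.mul_assoc, hga, Matrix.nonsing_inv_mul_cancel_left _ _ hg, Matrix.mul_neg,
    Matrix.mul_nonsing_inv_cancel_left _ _ hA, neg_neg]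

theorem sum_natDegree_eq_of_uEquiv {A₀ A₁ : Matrix (Fin n) (Fin n) F} {α : ℕ → F[X]}
    (hA : IsUnit A₁.det) (hαm : ∀ i < n, (α i).Monic)
    (h : UEquiv (pencilOf A₀ A₁) (Matrix.diagonal fun i : Fin n => α i)) :
    ∑ i ∈ Finset.range n, (α i).natDegree = n := by
  obtain ⟨U, V, hU, hV, h⟩ := h
  have h1 := natDegree_det_pencilOf (G₀ := A₀) hA
  have h2 : Associated (pencilOf A₀ A₁).det (∏ i : Fin n, α i) := by
    rw [h, Matrix.det_mul, Matrix.det_mul, Matrix.det_diagonal]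
    refine (associated_mul_unit_left _ _ hV).trans ?_
    rw [mul_comm]
    exact associated_mul_unit_left _ _ hU
  rw [natDegree_eq_of_degree_eq (degree_eq_degree_of_associated h2),
    Fin.prod_univ_eq_prod_range fun i => α i,
    natDegree_prod_of_monic _ _ fun i hi => hαm i (Finset.mem_range.1 hi)] at h1
  exact h1

theorem exists_rankReachable_le {A₀ A₁ B₀ B₁ : Matrix (Fin n) (Fin n) F} {α β : ℕ → F[X]} {r : ℕ}
    (hA : IsUnit A₁.det) (hB : IsUnit B₁.det)
    (hα : ∀ i, α i ∣ α (i + 1)) (hβ : ∀ i, β i ∣ β (i + 1))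
    (hαm : ∀ i < n, (α i).Monic) (hβm : ∀ i < n, (β i).Monic)
    (hAα : UEquiv (pencilOf A₀ A₁) (Matrix.diagonal fun i : Fin n => α i))
    (hBβ : UEquiv (pencilOf B₀ B₁) (Matrix.diagonal fun i : Fin n => β i))
    (h : ∀ i, i + r < n → α i ∣ β (i + r) ∧ β i ∣ α (i + r)) :
    ∃ ρ ≤ r, RankReachable A₀ A₁ B₀ B₁ ρ := by
  obtain ⟨a, b, ha, hb, hab⟩ := exists_realizes_rank_sub_le r hα hβ hαm hβm
    (sum_natDegree_eq_of_uEquiv hA hαm hAα) (sum_natDegree_eq_of_uEquiv hB hβm hBβ) h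
  obtain ⟨g, hg, hA₀⟩ := exists_similar_of_realizes hA hAα ha
  obtain ⟨k, hk, hB₀⟩ := exists_similar_of_realizes hB hBβ hb
  have hg' := Matrix.isUnit_nonsing_inv_det g hg
  have hk' := Matrix.isUnit_nonsing_inv_det k hk
  have hB' := Matrix.isUnit_nonsing_inv_det B₁ hB
  refine ⟨_, ?_, A₁ * g⁻¹ * k * B₁⁻¹, k⁻¹ * g, ?_, ?_, rfl⟩
  · have h1 : A₁ * g⁻¹ * k * B₁⁻¹ * B₁ * (k⁻¹ * g) = A₁ := by
      rw [Matrix.nonsing_inv_mul_cancel_right _ _ hB, Matrix.mul_assoc _ k,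
        Matrix.mul_nonsing_inv_cancel_left _ _ hk, Matrix.nonsing_inv_mul_cancel_right _ _ hg]
    have h2 : A₁ * g⁻¹ * k * B₁⁻¹ * B₀ * (k⁻¹ * g) = -(A₁ * (g⁻¹ * b * g)) := by
      rw [hB₀, Matrix.mul_neg, Matrix.neg_mul, ← Matrix.mul_assoc _ B₁,
        Matrix.nonsing_inv_mul_cancel_right _ _ hB]
      simp only [Matrix.mul_assoc]
      rw [Matrix.mul_nonsing_inv_cancel_left _ _ hk, Matrix.mul_nonsing_inv_cancel_left _ _ hk]
    have h3 : -(A₁ * (g⁻¹ * b * g)) - A₀ = A₁ * g⁻¹ * (a - b) * g := by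
      rw [hA₀]
      simp only [Matrix.mul_sub, Matrix.sub_mul, Matrix.mul_assoc]
      abel
    rw [h1, h2, sub_self, h3, pencilOf]
    rw [show (0 : Matrix (Fin n) (Fin n) F).map (C : F →+* F[X]) = 0 by ext1; simp, smul_zero,
      add_zero, normalRank_map_C]
    exact (Matrix.rank_mul_le_left _ _).trans ((Matrix.rank_mul_le_right _ _).trans hab)
  · simp only [Matrix.det_mul]
    exact ((hA.mul hg').mul hk).mul hB'
  · rw [Matrix.det_mul]
    exact hk'.mul hg

theorem exists_isUnit_det_and_sub_one (hn : 2 ≤ n) :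
    ∃ K : Matrix (Fin n) (Fin n) F, IsUnit K.det ∧ IsUnit (K - 1).det := by
  set p : F[X] := X ^ n - X + 1 with hp
  have hdeg : (-X + 1 : F[X]).degree < n := by
    refine (degree_add_le _ _).trans_lt ?_
    rw [degree_neg, degree_X, degree_one, max_eq_left (by norm_num)]
    exact_mod_cast hn
  have hpm : p.Monic := by
    rw [hp, sub_add_eq_add_sub, add_sub_assoc, show (1 : F[X]) - X = -X + 1 by ring]
    exact monic_X_pow_add hdeg
  have hpd : p.natDegree = n := by
    rw [hp, sub_add_eq_add_sub, add_sub_assoc, show (1 : F[X]) - X = -X + 1 by ring]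
    exact natDegree_eq_of_degree_eq_some (by
      rw [degree_add_eq_left_of_degree_lt (by rwa [degree_X_pow]), degree_X_pow])
  have hroot : AdjoinRoot.root p ^ n - AdjoinRoot.root p + 1 = 0 := by
    have := AdjoinRoot.eval₂_root p
    simpa [hp, eval₂_add, eval₂_sub] using this
  set u := AdjoinRoot.root p
  obtain ⟨m, rfl⟩ : ∃ m, n = m + 1 := ⟨n - 1, by omega⟩
  have hu : IsUnit u := IsUnit.of_mul_eq_one (1 - u ^ m) (by
    rw [pow_succ] at hroot
    linear_combination -hroot)
  have hu1 : IsUnit (u - 1) := by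
    obtain ⟨q, hq⟩ := sub_one_dvd_pow_sub_one u m
    refine IsUnit.of_mul_eq_one (-(u * q)) ?_
    rw [pow_succ] at hroot
    linear_combination u * hq - hroot
  let pb := AdjoinRoot.powerBasis' hpm
  let b := pb.basis.reindex (finCongr (show pb.dim = m + 1 from hpd))
  refine ⟨Algebra.leftMulMatrix b u, ?_, ?_⟩
  · exact (Matrix.isUnit_iff_isUnit_det _).1 (hu.map (Algebra.leftMulMatrix b))
  · rw [← map_one (Algebra.leftMulMatrix b), ← map_sub]
    exact (Matrix.isUnit_iff_isUnit_det _).1 (hu1.map (Algebra.leftMulMatrix b))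

end Reachable

section IntermediateRank
variable {F : Type*} [Field F] {n : ℕ} (M N : Matrix (Fin n) (Fin n) F[X])

/-- Left multiplication of `T * N` by `S` passes through all intermediate values of the normal rank
of the difference with `M`. -/
def PassesThroughRanks (S : Matrix (Fin n) (Fin n) F) : Prop :=
  ∀ T : Matrix (Fin n) (Fin n) F, IsUnit T.det → ∀ r, normalRank (T.map C * N - M) ≤ r →
    r ≤ normalRank ((S * T).map C * N - M) →
    ∃ T' : Matrix (Fin n) (Fin n) F, IsUnit T'.det ∧ normalRank (T'.map C * N - M) = r

variable {M N} {S : Matrix (Fin n) (Fin n) F}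

theorem passesThroughRanks_of_rank_sub_one_le (hS : IsUnit S.det) (h : (S - 1).rank ≤ 1) :
    PassesThroughRanks M N S := by
  intro T hT r h1 h2
  have h3 : (S * T).map (C : F →+* F[X]) * N - M =
      (T.map C * N - M) + (S - 1).map (C : F →+* F[X]) * (T.map C * N) := by
    rw [Matrix.map_mul, Matrix.map_sub _ (by simp), Matrix.map_one _ (by simp) (by simp),
      Matrix.sub_mul, Matrix.one_mul, Matrix.mul_assoc]
    abel
  have h4 : normalRank ((S * T).map C * N - M) ≤ normalRank (T.map C * N - M) + 1 := by
    rw [h3]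
    refine (normalRank_add_le _ _).trans (Nat.add_le_add_left ?_ _)
    exact (normalRank_mul_le_left _ _).trans ((normalRank_map_C _).le.trans h)
  rcases h1.eq_or_lt with h5 | h5
  · exact ⟨T, hT, h5⟩
  · exact ⟨S * T, by rw [Matrix.det_mul]; exact hS.mul hT, by omega⟩

theorem PassesThroughRanks.mul {S' : Matrix (Fin n) (Fin n) F} (hS' : IsUnit S'.det)
    (h : PassesThroughRanks M N S) (h' : PassesThroughRanks M N S') :
    PassesThroughRanks M N (S * S') := by
  intro T hT r h1 h2
  rcases le_total r (normalRank ((S' * T).map C * N - M)) with h3 | h3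
  · exact h' T hT r h1 h3
  · exact h (S' * T) (by rw [Matrix.det_mul]; exact hS'.mul hT) r h3
      (by rwa [← Matrix.mul_assoc])

theorem passesThroughRanks_diagonal (d : Fin n → F) (hd : ∀ i, d i ≠ 0) :
    PassesThroughRanks M N (Matrix.diagonal d) := by
  classical
  have key : ∀ s : Finset (Fin n),
      PassesThroughRanks M N (Matrix.diagonal fun i => if i ∈ s then d i else 1) := by
    intro s
    induction s using Finset.induction_on with
    | empty =>
      refine passesThroughRanks_of_rank_sub_one_le ?_ ?_ <;> simp
    | insert a s ha ih =>
      have h1 : (Matrix.diagonal fun i => if i ∈ insert a s then d i else 1) =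
          (Matrix.diagonal fun i => if i = a then d i else 1) *
            Matrix.diagonal fun i => if i ∈ s then d i else 1 := by
        rw [Matrix.diagonal_mul_diagonal]
        congr 1
        ext1 i
        by_cases hi : i = a
        · subst hi; simp [ha]
        · simp [hi]
      rw [h1]
      refine PassesThroughRanks.mul ?_ (passesThroughRanks_of_rank_sub_one_le ?_ ?_) ih
      · rw [Matrix.det_diagonal, isUnit_iff_ne_zero, Finset.prod_ne_zero_iff]
        intro i _
        split_ifs
        exacts [hd i, one_ne_zero]
      · rw [Matrix.det_diagonal, isUnit_iff_ne_zero, Finset.prod_ne_zero_iff]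
        intro i _
        split_ifs
        exacts [hd i, one_ne_zero]
      · rw [← Matrix.diagonal_one, Matrix.diagonal_sub]
        refine rank_le_one_of_mulVec (z := Pi.single a 1) fun x => ⟨(d a - 1) * x a, ?_⟩
        ext1 i
        by_cases hi : i = a
        · subst hi; simp [Matrix.mulVec_diagonal]
        · simp [Matrix.mulVec_diagonal, hi]
  simpa using key Finset.univ

theorem passesThroughRanks (hS : IsUnit S.det) : PassesThroughRanks M N S := by
  refine Matrix.diagonal_transvection_induction_of_det_ne_zero _ S hS.ne_zero ?_ ?_ ?_
  · intro D hD
    rw [Matrix.det_diagonal, Finset.prod_ne_zero_iff] at hD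
    exact passesThroughRanks_diagonal D fun i => hD i (Finset.mem_univ i)
  · intro t
    refine passesThroughRanks_of_rank_sub_one_le (by simp) ?_
    rw [Matrix.TransvectionStruct.toMatrix, Matrix.transvection, add_sub_cancel_left]
    refine rank_le_one_of_mulVec (z := Pi.single t.i 1) fun x => ⟨t.c * x t.j, ?_⟩
    ext1 k
    by_cases hk : k = t.i
    · subst hk; simp [Matrix.single_mulVec]
    · simp [Matrix.single_mulVec, hk]
  · intro A B _ hB h1 h2
    exact h1.mul hB.isUnit h2

theorem RankReachable.of_le {A₀ A₁ B₀ B₁ : Matrix (Fin n) (Fin n) F} {ρ r : ℕ} (hn : 2 ≤ n)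
    (hA : IsUnit A₁.det) (hB : IsUnit B₁.det) (h : RankReachable A₀ A₁ B₀ B₁ ρ)
    (hρ : ρ ≤ r) (hr : r ≤ n) : RankReachable A₀ A₁ B₀ B₁ r := by
  obtain ⟨Q, R, hQ, hR, hQR⟩ := h
  obtain ⟨K, hK, hK1⟩ := exists_isUnit_det_and_sub_one (F := F) hn
  have hmax : (A₁ * K * R⁻¹ * B₁⁻¹) * B₁ * R = A₁ * K := by
    rw [Matrix.nonsing_inv_mul_cancel_right _ _ hB, Matrix.nonsing_inv_mul_cancel_right _ _ hR]
  have hS : ∀ S : Matrix (Fin n) (Fin n) F, S.map C * (pencilOf B₀ B₁ * R.map C) - pencilOf A₀ A₁ =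
      pencilOf (S * B₀ * R - A₀) (S * B₁ * R - A₁) := by
    intro S
    rw [pencilOf_sub, ← map_mul_pencilOf_mul, Matrix.mul_assoc]
  have hmaxr : normalRank (pencilOf ((A₁ * K * R⁻¹ * B₁⁻¹) * B₀ * R - A₀)
      ((A₁ * K * R⁻¹ * B₁⁻¹) * B₁ * R - A₁)) = n := by
    refine normalRank_eq_of_det_ne_zero fun h0 => ?_
    have h1 : IsUnit ((A₁ * K * R⁻¹ * B₁⁻¹) * B₁ * R - A₁).det := by
      rw [hmax, show A₁ * K - A₁ = A₁ * (K - 1) by rw [Matrix.mul_sub, Matrix.mul_one],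
        Matrix.det_mul]
      exact hA.mul hK1
    have h2 := natDegree_det_pencilOf (G₀ := (A₁ * K * R⁻¹ * B₁⁻¹) * B₀ * R - A₀) h1
    rw [h0, natDegree_zero] at h2
    omega
  have hSu : IsUnit (A₁ * K * R⁻¹ * B₁⁻¹ * Q⁻¹).det := by
    simp only [Matrix.det_mul]
    exact (((hA.mul hK).mul (Matrix.isUnit_nonsing_inv_det R hR)).mul
      (Matrix.isUnit_nonsing_inv_det B₁ hB)).mul (Matrix.isUnit_nonsing_inv_det Q hQ)
  obtain ⟨T, hT, hTr⟩ := passesThroughRanks (M := pencilOf A₀ A₁) (N := pencilOf B₀ B₁ * R.map C)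
    hSu Q hQ r (by rw [hS, hQR]; exact hρ)
    (by rw [Matrix.nonsing_inv_mul_cancel_right _ _ hQ, hS, hmaxr]; exact hr)
  exact ⟨T, R, hT, hR, by rw [← hS, hTr]⟩

theorem rankReachable_iff_interlace {A₀ A₁ B₀ B₁ : Matrix (Fin n) (Fin n) F} {r : ℕ} (hn : 2 ≤ n)
    (hA : IsUnit A₁.det) (hB : IsUnit B₁.det) {φ ψ : ℕ → MvPolynomial (Fin 2) F}
    (hφ : IsHomogeneousIF A₀ A₁ φ) (hψ : IsHomogeneousIF B₀ B₁ ψ) (hr : r ≤ n) :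
    RankReachable A₀ A₁ B₀ B₁ r ↔ Interlace n r φ ψ := by
  have hdet : ∀ {G₀ G₁ : Matrix (Fin n) (Fin n) F}, IsUnit G₁.det → (pencilOf G₀ G₁).det ≠ 0 := by
    intro G₀ G₁ hG h0
    have := natDegree_det_pencilOf (G₀ := G₀) hG
    rw [h0, natDegree_zero] at this
    omega
  obtain ⟨α, hαm, hα, hAα⟩ := exists_smith (pencilOf A₀ A₁) (hdet hA)
  obtain ⟨β, hβm, hβ, hBβ⟩ := exists_smith (pencilOf B₀ B₁) (hdet hB)
  rw [interlace_iff_of_uEquiv hφ hA hα hαm hAα hψ hB hβ hβm hBβ]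
  constructor
  · rintro ⟨Q, R, hQ, hR, h⟩ i hi
    rw [pencilOf_sub, ← map_mul_pencilOf_mul] at h
    have hN := ((UEquiv.of_right_mul (isUnit_det_map_C hR) _).trans
      (UEquiv.of_left_mul (isUnit_det_map_C hQ) (pencilOf B₀ B₁))).trans hBβ
    refine ⟨dvd_of_normalRank_sub_le hα hβ hβm hAα hN h.le hi,
      dvd_of_normalRank_sub_le hβ hα hαm hN hAα ?_ hi⟩
    rw [← neg_sub, normalRank_neg, h]
  · intro h
    obtain ⟨ρ, hρ, hreach⟩ := exists_rankReachable_le hA hB hα hβ hαm hβm hAα hBβ h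
    exact hreach.of_le hn hA hB hρ hr

end IntermediateRank

end

/-- Main theorem. For `n ≥ 2`, regular pencils `A(s)`, `B(s)` with homogeneous
invariant factors `φ`, `ψ`, some `c ∈ F ∪ {∞}` outside both spectra, and `0 ≤ r ≤ n`:
there is a pencil `P(s)` of normal rank exactly `r` with `A(s) + P(s)` strictly equivalent to
`B(s)` iff the interlacing conditions hold. -/
theorem stmt14 (F : Type*) [Field F] (n : ℕ) (hn : 2 ≤ n)
    (A₀ A₁ B₀ B₁ : Matrix (Fin n) (Fin n) F)
    (hA : (pencilOf A₀ A₁).det ≠ 0) (hB : (pencilOf B₀ B₁).det ≠ 0)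
    (φ ψ : ℕ → MvPolynomial (Fin 2) F)
    (hφ : IsHomogeneousIF A₀ A₁ φ) (hφc : ∀ i, i + 1 < n → φ i ∣ φ (i + 1))
    (hψ : IsHomogeneousIF B₀ B₁ ψ) (hψc : ∀ i, i + 1 < n → ψ i ∣ ψ (i + 1))
    (hc : (∃ c : F, IsUnit (A₀ + c • A₁).det ∧ IsUnit (B₀ + c • B₁).det) ∨
      (IsUnit A₁.det ∧ IsUnit B₁.det))
    (r : ℕ) (hr : r ≤ n) :
    (∃ P : Matrix (Fin n) (Fin n) (Polynomial F), IsPencil P ∧ normalRank P = r ∧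
        StrictEquiv (pencilOf A₀ A₁ + P) (pencilOf B₀ B₁)) ↔
      Interlace n r φ ψ := by
  rw [exists_pencil_iff_rankReachable]
  rcases hc with ⟨c, hAc, hBc⟩ | ⟨hA₁, hB₁⟩
  · rw [← RankReachable.invert_iff c,
      rankReachable_iff_interlace hn hAc hBc (hφ.invert c) (hψ.invert c) hr]
    exact interlace_map_equiv (invertEquiv c).toRingEquiv
  · exact rankReachable_iff_interlace hn hA₁ hB₁ hφ hψ hr
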